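/- arXiv:2011.13496 — 2 statements merged into one kernel-verified Lean document; each statement's English description precedes it below -/
import Mathlib

section
/- Consider the two-sample testing problem with alternative parameters ε = ε_n ∈ (0,1/2) and μ = μ_n > 0 possibly varying with n. If √n ε_n (1/2 − ∫ F(x − μ_n) dF(x)) → 0 as n → ∞, then under the alternative H1 the standardized Wilcoxon statistic (U − mn/2)/√(mn(m+n+1)/12) converges in distribution to the standard normal law — the same limiting distribution it has under the null H0 — so the Wilcoxon test is asymptotically powerless: no sequence of tests based on U can have the sum of its type I and type II error probabilities bounded away from 1. -/
open MeasureTheory ProbabilityTheory Filter Set Topology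

/-- The Mann–Whitney/Wilcoxon statistic: the number of pairs (i,j) with X_i < Y_j. -/
noncomputable def Ustat {m n : ℕ} (x : Fin m → ℝ) (y : Fin n → ℝ) : ℕ :=
  ((Finset.univ ×ˢ Finset.univ).filter fun p : Fin m × Fin n => x p.1 < y p.2).card

lemma binom_sq_sum (N : ℕ) :
    ∑ j ∈ Finset.range (N+1), (N.choose j : ℝ) * ((N:ℝ) - 2 * j)^2 = (N:ℝ) * 2^N := by
  have h := congrArg (Polynomial.eval (1/2 : ℝ)) (bernsteinPolynomial.variance ℝ N)
  simp only [Polynomial.eval_finsetSum, bernsteinPolynomial, Polynomial.eval_mul,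
    Polynomial.eval_pow, Polynomial.eval_sub, Polynomial.eval_X,
    Polynomial.eval_one, Polynomial.eval_natCast, nsmul_eq_mul] at h
  have h2 : ∀ j ∈ Finset.range (N+1), (N.choose j : ℝ) * ((N:ℝ) - 2 * j)^2 =
     4 * 2^N * (((N:ℝ) * (1/2) - j)^2 * ((N.choose j : ℝ) * (1/2)^j * (1-1/2)^(N-j))) := by
    intro j hj
    have hj' : j ≤ N := by simpa [Nat.lt_succ_iff] using hj
    have : (2:ℝ)^N * ((1/2)^j * (1-1/2)^(N-j)) = 1 := by
      rw [show (1-1/2:ℝ) = 1/2 by norm_num, ← pow_add, Nat.add_sub_cancel' hj', ← mul_pow]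
      norm_num
    calc _ = 4 * ((N:ℝ) * (1/2) - j)^2 * (N.choose j : ℝ) * 1 := by ring
      _ = 4 * ((N:ℝ) * (1/2) - j)^2 * (N.choose j : ℝ) * ((2:ℝ)^N * ((1/2)^j * (1-1/2)^(N-j))) := by rw [this]
      _ = _ := by ring
  rw [Finset.sum_congr rfl h2, ← Finset.mul_sum]
  rw [h]; ring

lemma binom_abs_sum (N : ℕ) :
    ∑ j ∈ Finset.range (N+1), (N.choose j : ℝ) * |(N:ℝ) - 2 * j| ≤ 2^N * √N := by
  have h1 : (∑ j ∈ Finset.range (N+1), (N.choose j : ℝ) * |(N:ℝ) - 2 * j|)^2 ≤ (2^N * √N)^2 := by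
    have hcs := Finset.sum_mul_sq_le_sq_mul_sq (Finset.range (N+1)) (fun j => √(N.choose j : ℝ))
      (fun j => √(N.choose j : ℝ) * |(N:ℝ) - 2 * j|)
    have e1 : ∀ j ∈ Finset.range (N+1), √(N.choose j : ℝ) * (√(N.choose j : ℝ) * |(N:ℝ) - 2 * j|)
      = (N.choose j : ℝ) * |(N:ℝ) - 2 * j| := by
      intro j _; rw [← mul_assoc, Real.mul_self_sqrt (by positivity)]
    have e2 : ∀ j ∈ Finset.range (N+1), √(N.choose j : ℝ)^2 = (N.choose j : ℝ) := by
      intro j _; rw [Real.sq_sqrt (by positivity)]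
    have e3 : ∀ j ∈ Finset.range (N+1), (√(N.choose j : ℝ) * |(N:ℝ) - 2 * j|)^2 =
       (N.choose j : ℝ) * ((N:ℝ) - 2 * j)^2 := by
      intro j _; rw [mul_pow, Real.sq_sqrt (by positivity), sq_abs]
    rw [Finset.sum_congr rfl e1, Finset.sum_congr rfl e2, Finset.sum_congr rfl e3,
      binom_sq_sum] at hcs
    have e4 : ∑ j ∈ Finset.range (N+1), (N.choose j : ℝ) = 2^N := by
      exact_mod_cast Nat.sum_range_choose N
    rw [e4] at hcs
    rw [mul_pow, Real.sq_sqrt (by positivity)]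
    linarith [hcs, show (2:ℝ)^N * (N * 2^N) = (2^N)^2 * N by ring]
  exact (abs_le_of_sq_le_sq' h1 (by positivity)).2

lemma norm_binom_diff {A : Type*} [NormedRing A] [NormedAlgebra ℝ A] (h1 : ‖(1:A)‖ ≤ 1) (u : A)
    (hu : ‖u‖ ≤ 1) (K : ℕ) : ‖(1+u)^K * (1-u)‖ ≤ 2^(K+1) / √(K+1) := by
  have hpow : ∀ j, ‖u^j‖ ≤ 1 := by
    intro j
    induction j with
    | zero => simpa using h1
    | succ j ih => rw [pow_succ]; exact (norm_mul_le _ _).trans (mul_le_one₀ ih (norm_nonneg _) hu)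
  have hb : ∀ N : ℕ, (1+u)^N = ∑ j ∈ Finset.range (N+1), (N.choose j : ℝ) • u^j := by
    intro N
    rw [add_comm, (Commute.one_right u).add_pow]
    refine Finset.sum_congr rfl fun j _ => ?_
    rw [one_pow, mul_one, Nat.cast_smul_eq_nsmul, nsmul_eq_mul, Nat.cast_comm]
  have hd : ∑ j ∈ Finset.range (K+2), ((K+1).choose j * (j:ℝ)) • u^j = ((K:ℝ)+1) • (u * (1+u)^K) := by
    rw [Finset.sum_range_succ', hb, Finset.mul_sum, Finset.smul_sum]
    simp only [Nat.cast_zero, mul_zero, zero_smul, add_zero]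
    refine Finset.sum_congr rfl fun j _ => ?_
    rw [mul_smul_comm, smul_smul, ← pow_succ']
    congr 1
    have := Nat.add_one_mul_choose_eq K j
    have h' : ((K:ℝ)+1) * K.choose j = (K+1).choose (j+1) * ((j:ℝ)+1) := by exact_mod_cast this
    rw [h']; push_cast; ring
  have key : ((K:ℝ)+1) • ((1+u)^K * (1-u)) =
      ∑ j ∈ Finset.range (K+2), ((K+1).choose j * ((K+1:ℕ) - 2 * (j:ℝ))) • u^j := by
    have : ∀ j ∈ Finset.range (K+2), ((K+1).choose j * ((K+1:ℕ) - 2 * (j:ℝ))) • u^j =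
       ((K:ℝ)+1) • (((K+1).choose j : ℝ) • u^j) - (2:ℝ) • (((K+1).choose j * (j:ℝ)) • u^j) := by
      intro j _
      rw [smul_smul, smul_smul, ← sub_smul]; congr 1; push_cast; ring
    rw [Finset.sum_congr rfl this, Finset.sum_sub_distrib, ← Finset.smul_sum, ← Finset.smul_sum,
      hd, ← hb, smul_smul, mul_comm (2:ℝ), ← smul_smul, ← smul_sub]
    congr 1
    have hc : u * (1+u)^K = (1+u)^K * u :=
      ((Commute.one_right u).add_right (Commute.refl u)).pow_right K
    rw [hc, pow_succ, two_smul]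
    noncomm_ring
  have hn : ((K:ℝ)+1) * ‖(1+u)^K * (1-u)‖ ≤ 2^(K+1) * √((K+1:ℕ):ℝ) := by
    have e : ((K:ℝ)+1) * ‖(1+u)^K * (1-u)‖ = ‖((K:ℝ)+1) • ((1+u)^K * (1-u))‖ := by
      rw [norm_smul, Real.norm_of_nonneg (by positivity)]
    rw [e, key]
    refine (norm_sum_le _ _).trans (le_trans ?_ (binom_abs_sum (K+1)))
    refine Finset.sum_le_sum fun j _ => ?_
    rw [norm_smul, Real.norm_eq_abs, abs_mul, abs_of_nonneg (by positivity : (0:ℝ) ≤ ((K+1).choose j : ℝ))]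
    exact mul_le_of_le_one_right (by positivity) (hpow j)
  have hs : (0:ℝ) < √((K:ℝ)+1) := by positivity
  rw [le_div_iff₀ hs]
  have hsq : √((K:ℝ)+1) * √((K:ℝ)+1) = K+1 := Real.mul_self_sqrt (by positivity)
  push_cast at hn
  refine le_of_mul_le_mul_right ?_ hs
  rw [mul_assoc, hsq, mul_comm]
  exact hn

lemma binom_inv_sqrt (M : ℕ) (c : ℝ) (hc0 : 0 < c) (hc1 : c ≤ 1) :
    ∑ K ∈ Finset.range (M+1), (M.choose K : ℝ) * c^K * (1-c)^(M-K) * (1/√((K:ℝ)+1))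
      ≤ 1/√(c*(M+1)) := by
  set p : ℕ → ℝ := fun K => (M.choose K : ℝ) * c^K * (1-c)^(M-K) with hp
  have hp0 : ∀ K, 0 ≤ p K := fun K => by
    have : 0 ≤ 1 - c := by linarith
    positivity
  have hp1 : ∑ K ∈ Finset.range (M+1), p K = 1 := by
    have := add_pow c (1-c) M
    rw [add_sub_cancel, one_pow] at this
    rw [this]; refine Finset.sum_congr rfl fun K _ => ?_
    simp only [hp]; ring
  have hp2 : ∑ K ∈ Finset.range (M+1), p K / ((K:ℝ)+1) ≤ 1/(c*(M+1)) := by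
    have hE : c * (M+1) * ∑ K ∈ Finset.range (M+1), p K / ((K:ℝ)+1) ≤ 1 := by
      have := add_pow c (1-c) (M+1)
      rw [add_sub_cancel, one_pow, Finset.sum_range_succ'] at this
      have h0 : 0 ≤ c ^ 0 * (1 - c) ^ (M + 1 - 0) * ((M + 1).choose 0 : ℝ) := by
        have : 0 ≤ 1 - c := by linarith
        positivity
      refine le_trans (le_of_eq ?_) (le_of_le_of_eq (le_add_of_nonneg_right h0) this.symm)
      rw [Finset.mul_sum]
      refine Finset.sum_congr rfl fun K _ => ?_
      have h' : ((M:ℝ)+1) * M.choose K = (M+1).choose (K+1) * ((K:ℝ)+1) := by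
        exact_mod_cast Nat.add_one_mul_choose_eq M K
      rw [Nat.add_sub_add_right]
      have hK : (K:ℝ)+1 ≠ 0 := by positivity
      simp only [hp]
      field_simp
      calc _ = (((M:ℝ)+1) * M.choose K) * c^(K+1) * (1-c)^(M-K) := by ring
        _ = _ := by rw [h']; ring
    rw [le_div_iff₀ (by positivity)]; linarith
  have hcs := Finset.sum_mul_sq_le_sq_mul_sq (Finset.range (M+1)) (fun K => √(p K))
      (fun K => √(p K) * (1/√((K:ℝ)+1)))
  have e1 : ∀ K ∈ Finset.range (M+1), √(p K) * (√(p K) * (1/√((K:ℝ)+1))) = p K * (1/√((K:ℝ)+1)) := by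
    intro K _; rw [← mul_assoc, Real.mul_self_sqrt (hp0 K)]
  have e2 : ∀ K ∈ Finset.range (M+1), √(p K)^2 = p K := by
    intro K _; rw [Real.sq_sqrt (hp0 K)]
  have e3 : ∀ K ∈ Finset.range (M+1), (√(p K) * (1/√((K:ℝ)+1)))^2 = p K / ((K:ℝ)+1) := by
    intro K _; rw [mul_pow, Real.sq_sqrt (hp0 K), div_pow, Real.sq_sqrt (by positivity)]; ring
  rw [Finset.sum_congr rfl e1, Finset.sum_congr rfl e2, Finset.sum_congr rfl e3, hp1, one_mul] at hcs
  refine (abs_le_of_sq_le_sq' ?_ (by positivity)).2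
  rw [div_pow, Real.sq_sqrt (by positivity), one_pow]
  exact hcs.trans hp2

lemma mineka {A : Type*} [NormedRing A] [NormedAlgebra ℝ A] (h1 : ‖(1:A)‖ ≤ 1) (R Q u : A)
    (hu : ‖u‖ ≤ 1) (c : ℝ) (hc0 : 0 < c) (hc1 : c ≤ 1) (hR : ‖R‖ ≤ 1 - c) (hQ : ‖Q‖ ≤ c)
    (hRQ : Commute R Q) (hRu : Commute R u) (hQu : Commute Q u) (M : ℕ) :
    ‖((1/2:ℝ) • (Q * (1+u)) + R)^M * (1-u)‖ ≤ 2 / √(c*(M+1)) := by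
  have hnp : ∀ (x : A) (a : ℝ), ‖x‖ ≤ a → ∀ j, ‖x^j‖ ≤ a^j := by
    intro x a hx j
    induction j with
    | zero => simpa using h1
    | succ j ih =>
      rw [pow_succ, pow_succ]
      exact (norm_mul_le _ _).trans (mul_le_mul ih hx (norm_nonneg _) ((norm_nonneg _).trans ih))
  have hQ1u : Commute Q (1+u) := (Commute.one_right Q).add_right hQu
  have hR1u : Commute R (1+u) := (Commute.one_right R).add_right hRu
  have hcomm : Commute ((1/2:ℝ) • (Q * (1+u))) R :=
    ((hRQ.mul_right hR1u).smul_right _).symm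
  rw [hcomm.add_pow, Finset.sum_mul]
  refine (norm_sum_le _ _).trans ?_
  have hb : ∀ K ∈ Finset.range (M+1),
      ‖((1/2:ℝ) • (Q * (1+u)))^K * R^(M-K) * (M.choose K : A) * (1-u)‖ ≤
      2 * ((M.choose K : ℝ) * c^K * (1-c)^(M-K) * (1/√((K:ℝ)+1))) := by
    intro K _
    have e : ((1/2:ℝ) • (Q * (1+u)))^K * R^(M-K) * (M.choose K : A) * (1-u) =
        ((M.choose K : ℝ) * (1/2)^K) • (R^(M-K) * Q^K * ((1+u)^K * (1-u))) := by
      rw [(hcomm.pow_pow K (M-K)).eq, smul_pow, hQ1u.mul_pow, mul_smul, Nat.cast_smul_eq_nsmul,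
        nsmul_eq_mul, (Nat.cast_commute (M.choose K) _).eq, mul_assoc, mul_assoc,
        (Nat.cast_commute (M.choose K) (1-u)).eq]
      simp only [mul_smul_comm, smul_mul_assoc, mul_assoc]
    rw [e, norm_smul, Real.norm_of_nonneg (by positivity)]
    have hn : ‖R^(M-K) * Q^K * ((1+u)^K * (1-u))‖ ≤ (1-c)^(M-K) * c^K * (2^(K+1) / √(K+1)) := by
      have h0 : 0 ≤ 1 - c := by linarith
      refine (norm_mul_le _ _).trans (mul_le_mul ?_ (norm_binom_diff h1 u hu K) (norm_nonneg _) (by positivity))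
      exact (norm_mul_le _ _).trans (mul_le_mul (hnp _ _ hR _) (hnp _ _ hQ _) (norm_nonneg _) (by positivity))
    refine (mul_le_mul_of_nonneg_left hn (by positivity)).trans (le_of_eq ?_)
    have : (1/2:ℝ)^K * 2^(K+1) = 2 := by rw [pow_succ, ← mul_assoc, ← mul_pow]; norm_num
    calc _ = ((1/2:ℝ)^K * 2^(K+1)) * ((M.choose K : ℝ) * c^K * (1-c)^(M-K) * (1/√((K:ℝ)+1))) := by ring
      _ = _ := by rw [this]
  refine (Finset.sum_le_sum hb).trans ?_
  rw [← Finset.mul_sum]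
  have := binom_inv_sqrt M c hc0 hc1
  calc _ ≤ 2 * (1 / √(c*(M+1))) := by gcongr
    _ = _ := by ring

abbrev BE := BoundedContinuousFunction ℕ ℝ

noncomputable def shf : BE →L[ℝ] BE :=
  LinearMap.mkContinuous
    { toFun := fun f => f.compContinuous ⟨fun k => k + 1, continuous_of_discreteTopology⟩
      map_add' := fun f g => by ext; rfl
      map_smul' := fun c f => by ext; rfl } 1
    (fun f => by
      rw [one_mul]
      refine (BoundedContinuousFunction.norm_le (norm_nonneg _)).2 fun k => ?_
      exact f.norm_coe_le_norm _)

lemma shf_apply (f : BE) (a : ℕ) : shf f a = f (a+1) := rfl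

lemma shf_pow_apply (k : ℕ) (f : BE) (a : ℕ) : (shf^k) f a = f (a+k) := by
  induction k generalizing a with
  | zero => simp
  | succ k ih =>
    rw [pow_succ', mul_apply_eq_comp, shf_apply, ih]; congr 1; ring

lemma shf_norm : ‖shf‖ ≤ 1 := LinearMap.mkContinuous_norm_le _ zero_le_one _

lemma one_norm : ‖(1 : BE →L[ℝ] BE)‖ ≤ 1 := ContinuousLinearMap.norm_id_le

lemma tpow_norm {A : Type} [NormedRing A] [NormedAlgebra ℝ A] (h1 : ‖(1:A)‖ ≤ 1) (τ : A) (ht : ‖τ‖ ≤ 1) (k : ℕ) : ‖τ^k‖ ≤ 1 := by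
  induction k with
  | zero => simpa using h1
  | succ j ih => rw [pow_succ]; exact (norm_mul_le _ _).trans (mul_le_one₀ ih (norm_nonneg _) ht)

/-- convolution operator with weights w on 0..m -/
noncomputable def cop {A : Type} [NormedRing A] [NormedAlgebra ℝ A] (τ : A) (m : ℕ) (w : ℕ → ℝ) : A := ∑ k ∈ Finset.range (m+1), w k • τ^k

lemma cop_commute_t {A : Type} [NormedRing A] [NormedAlgebra ℝ A] (τ : A) (m : ℕ) (w : ℕ → ℝ) (k : ℕ) : Commute (cop τ m w) (τ^k) := by
  unfold cop
  refine Commute.sum_left _ _ _ fun i _ => ?_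
  exact ((Commute.refl τ).pow_pow i k).smul_left _

lemma cop_commute {A : Type} [NormedRing A] [NormedAlgebra ℝ A] (τ : A) (m m' : ℕ) (w w' : ℕ → ℝ) : Commute (cop τ m w) (cop τ m' w') := by
  conv => arg 2; unfold cop
  refine Commute.sum_right _ _ _ fun i _ => ?_
  exact (cop_commute_t τ m w i).smul_right _

lemma cop_norm {A : Type} [NormedRing A] [NormedAlgebra ℝ A] (h1 : ‖(1:A)‖ ≤ 1) (τ : A) (ht : ‖τ‖ ≤ 1) (m : ℕ) (w : ℕ → ℝ) (hw : ∀ k ≤ m, 0 ≤ w k) :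
    ‖cop τ m w‖ ≤ ∑ k ∈ Finset.range (m+1), w k := by
  unfold cop
  refine (norm_sum_le _ _).trans (Finset.sum_le_sum fun k hk => ?_)
  have := hw k (by simpa [Nat.lt_succ_iff] using hk)
  rw [norm_smul, Real.norm_of_nonneg this]
  exact mul_le_of_le_one_right this (tpow_norm h1 τ ht k)

/-- overlap implies smoothing -/
lemma cop_smooth {A : Type} [NormedRing A] [NormedAlgebra ℝ A] (h1 : ‖(1:A)‖ ≤ 1) (τ : A) (ht : ‖τ‖ ≤ 1) (m : ℕ) (w : ℕ → ℝ) (hw : ∀ k, 0 ≤ w k) (hw1 : ∑ k ∈ Finset.range (m+1), w k = 1)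
    (κ : ℝ) (hκ : 0 < κ) (hm : 4 ≤ m)
    (hbad : 8 * ((Finset.range (m+1)).filter fun k => w k < κ / m).card ≤ m)
    (s : ℕ) (hs : 4 * s ≤ m) (M : ℕ) :
    ‖(cop τ m w)^M * (1 - τ^s)‖ ≤ 2 / √(κ / 2 * (M+1)) := by
  have hm0 : (0:ℝ) < m := by exact_mod_cast (by omega : 0 < m)
  set G : Finset ℕ := (Finset.range (m+1-s)).filter fun k => κ / m ≤ w k ∧ κ/m ≤ w (k+s) with hG
  set c : ℝ := κ / m * G.card with hc
  set q : ℕ → ℝ := fun k => if k ∈ G then κ / m else 0 with hq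
  set q' : ℕ → ℝ := fun k => if s ≤ k ∧ k - s ∈ G then κ / m else 0 with hq'
  set r : ℕ → ℝ := fun k => w k - (q k + q' k)/2 with hr
  have hGsub : G ⊆ Finset.range (m+1) := by
    intro k hk
    simp only [hG, Finset.mem_filter, Finset.mem_range] at hk ⊢
    omega
  -- card bound
  have hcard : m ≤ 2 * G.card := by
    set B := (Finset.range (m+1)).filter fun k => w k < κ / m with hB
    have hsub : Finset.range (m+1-s) ⊆ G ∪ (B ∪ (B.image fun k => k - s)) := by
      intro k hk
      simp only [Finset.mem_range] at hk
      simp only [Finset.mem_union, Finset.mem_image, hG, hB, Finset.mem_filter, Finset.mem_range]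
      by_cases h1 : κ / m ≤ w k
      · by_cases h2 : κ / m ≤ w (k+s)
        · left; exact ⟨hk, h1, h2⟩
        · right; right; exact ⟨k+s, ⟨by omega, not_le.1 h2⟩, by omega⟩
      · right; left; exact ⟨by omega, not_le.1 h1⟩
    have h1 := Finset.card_le_card hsub
    have h2 := Finset.card_union_le G (B ∪ (B.image fun k => k - s))
    have h3 := Finset.card_union_le B (B.image fun k => k - s)
    have h4 : (B.image fun k => k - s).card ≤ B.card := Finset.card_image_le
    rw [Finset.card_range] at h1
    omega
  have hcκ : κ / 2 ≤ c := by
    have : (m:ℝ) ≤ 2 * G.card := by exact_mod_cast hcard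
    rw [hc, div_mul_eq_mul_div, le_div_iff₀ hm0]
    nlinarith
  have hc0 : 0 < c := by linarith
  have hqsum : ∑ k ∈ Finset.range (m+1), q k = c := by
    simp only [hq]
    rw [← Finset.sum_filter, Finset.sum_const, nsmul_eq_mul, hc, mul_comm]
    congr 2
    congr 1
    ext k; simp only [Finset.mem_filter]; exact ⟨fun h => h.2, fun h => ⟨hGsub h, h⟩⟩
  have hq'op : ∀ {V : Type} [AddCommGroup V] [Module ℝ V] (g : ℕ → V),
      ∑ k ∈ Finset.range (m+1), q' k • g k = ∑ k ∈ Finset.range (m+1), q k • g (k+s) := by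
    intro V _ _ g
    have hL : ∑ k ∈ Finset.range (m+1), q' k • g k = ∑ k ∈ G, (κ/m) • g (k+s) := by
      simp only [hq', ite_smul, zero_smul]
      rw [← Finset.sum_filter]
      refine Finset.sum_bij' (fun k _ => k - s) (fun k _ => k + s) ?_ ?_ ?_ ?_ ?_
      · intro k hk; simp only [Finset.mem_filter] at hk; exact hk.2.2
      · intro k hk
        have := hk
        simp only [hG, Finset.mem_filter, Finset.mem_range] at this
        simp only [Finset.mem_filter, Finset.mem_range, Nat.add_sub_cancel]
        exact ⟨by omega, by omega, hk⟩
      · intro k hk; simp only [Finset.mem_filter] at hk; omega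
      · intro k hk; omega
      · intro k hk; simp only [Finset.mem_filter] at hk; rw [Nat.sub_add_cancel hk.2.1]
    have hR : ∑ k ∈ Finset.range (m+1), q k • g (k+s) = ∑ k ∈ G, (κ/m) • g (k+s) := by
      simp only [hq, ite_smul, zero_smul]
      rw [← Finset.sum_filter]
      refine Finset.sum_congr ?_ fun _ _ => rfl
      ext k; simp only [Finset.mem_filter]; exact ⟨fun h => h.2, fun h => ⟨hGsub h, h⟩⟩
    rw [hL, hR]
  have hq'sum : ∑ k ∈ Finset.range (m+1), q' k = c := by
    have := hq'op (fun _ => (1:ℝ))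
    simpa [hqsum] using this
  have hκm : 0 < κ / m := by positivity
  have hr0 : ∀ k ≤ m, 0 ≤ r k := by
    intro k _
    have h1 : q k ≤ w k := by
      simp only [hq]; split_ifs with h
      · simp only [hG, Finset.mem_filter] at h; exact h.2.1
      · exact hw k
    have h2 : q' k ≤ w k := by
      simp only [hq']; split_ifs with h
      · have h' := h.2
        simp only [hG, Finset.mem_filter] at h'
        rw [Nat.sub_add_cancel h.1] at h'
        exact h'.2.2
      · exact hw k
    simp only [hr]; linarith
  have hrsum : ∑ k ∈ Finset.range (m+1), r k = 1 - c := by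
    simp only [hr]
    rw [Finset.sum_sub_distrib, hw1, ← Finset.sum_div, Finset.sum_add_distrib, hqsum, hq'sum]; ring
  have hdec : cop τ m w = (1/2:ℝ) • (cop τ m q * (1 + τ^s)) + cop τ m r := by
    have e1 : cop τ m q * τ^s = cop τ m q' := by
      unfold cop
      rw [hq'op, Finset.sum_mul]
      refine Finset.sum_congr rfl fun k _ => ?_
      rw [smul_mul_assoc, pow_add]
    rw [mul_add, mul_one, e1]
    unfold cop
    rw [← Finset.sum_add_distrib, Finset.smul_sum, ← Finset.sum_add_distrib]
    refine Finset.sum_congr rfl fun k _ => ?_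
    rw [← add_smul, smul_smul, ← add_smul]
    congr 1
    simp only [hr]; ring
  have hr1 : 0 ≤ 1 - c := by
    rw [← hrsum]; exact Finset.sum_nonneg fun k hk => hr0 k (by simpa [Nat.lt_succ_iff] using hk)
  have hq0 : ∀ k ≤ m, 0 ≤ q k := by
    intro k _; simp only [hq]; split_ifs <;> linarith
  rw [hdec]
  refine (mineka h1 (cop τ m r) (cop τ m q) (τ^s) (tpow_norm h1 τ ht s) c hc0 (by linarith)
    ((cop_norm h1 τ ht m r hr0).trans hrsum.le) ((cop_norm h1 τ ht m q hq0).trans hqsum.le)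
    (cop_commute τ _ _ _ _) (cop_commute_t τ _ _ _) (cop_commute_t τ _ _ _) M).trans ?_
  gcongr

lemma cop_smooth' {A : Type} [NormedRing A] [NormedAlgebra ℝ A] (h1 : ‖(1:A)‖ ≤ 1) (τ : A) (ht : ‖τ‖ ≤ 1) (m : ℕ) (w : ℕ → ℝ) (g : ℝ) (M s0 : ℕ) (hs0 : 0 < s0)
    (hg : ∀ s ≤ s0, ‖(cop τ m w)^M * (1 - τ^s)‖ ≤ g) (d : ℕ) :
    ‖(cop τ m w)^M * (1 - τ^d)‖ ≤ ((d:ℝ) / s0 + 1) * g := by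
  have hg0 : 0 ≤ g := (norm_nonneg _).trans (hg 0 (Nat.zero_le _))
  have hadd : ∀ a b, ‖(cop τ m w)^M * (1 - τ^(a+b))‖ ≤
      ‖(cop τ m w)^M * (1 - τ^a)‖ + ‖(cop τ m w)^M * (1 - τ^b)‖ := by
    intro a b
    have : (cop τ m w)^M * (1 - τ^(a+b)) =
       (cop τ m w)^M * (1 - τ^a) + ((cop τ m w)^M * (1 - τ^b)) * τ^a := by
      rw [mul_assoc, sub_mul, one_mul, ← pow_add, ← mul_add, add_comm b a]; congr 1; abel
    rw [this]
    refine (norm_add_le _ _).trans (add_le_add le_rfl ?_)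
    refine (norm_mul_le _ _).trans (mul_le_of_le_one_right (norm_nonneg _) (tpow_norm h1 τ ht a))
  have hq : ∀ q : ℕ, ‖(cop τ m w)^M * (1 - τ^(q * s0))‖ ≤ q * g := by
    intro q
    induction q with
    | zero => simp
    | succ q ih =>
      rw [Nat.succ_mul]
      refine (hadd _ _).trans ?_
      push_cast
      linarith [hg s0 le_rfl]
  have h := hadd (d / s0 * s0) (d % s0)
  rw [Nat.div_add_mod'] at h
  have h2 := hg (d % s0) (Nat.mod_lt _ hs0).le
  have h3 : ((d / s0 : ℕ) : ℝ) ≤ (d:ℝ)/s0 := Nat.cast_div_le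
  have h4 := hq (d/s0)
  nlinarith

lemma cop_apply (P : Measure ℝ) [IsProbabilityMeasure P] (m : ℕ) (N : ℝ → ℕ) (hN : Measurable N)
    (hNm : ∀ y, N y ≤ m) (f : BE) (a : ℕ) :
    cop shf m (fun k => P.real {y | N y = k}) f a = ∫ y, f (a + N y) ∂P := by
  have e : ∀ y, f (a + N y) = ∑ k ∈ Finset.range (m+1), Set.indicator {y | N y = k} (fun _ => f (a+k)) y := by
    intro y
    rw [Finset.sum_eq_single (N y)]
    · simp
    · intro k _ hk; simp [Set.indicator, hk.symm]
    · intro h; exact absurd (Finset.mem_range.2 (Nat.lt_succ_of_le (hNm y))) h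
  have hms : ∀ k, MeasurableSet {y | N y = k} := fun k => hN (measurableSet_singleton k)
  simp_rw [e]
  rw [integral_finsetSum]
  · unfold cop
    rw [sum_apply, BoundedContinuousFunction.coe_sum, Finset.sum_apply]
    refine Finset.sum_congr rfl fun k _ => ?_
    rw [integral_indicator_const _ (hms k), smul_apply,
      BoundedContinuousFunction.coe_smul]
    simp only [shf_pow_apply]
  · intro k _
    exact (integrable_const _).indicator (hms k)

lemma BE_comp_integrable {α : Type*} [MeasurableSpace α] (μ : Measure α) [IsFiniteMeasure μ]
    (f : BE) (N : α → ℕ) (hN : Measurable N) : Integrable (fun y => f (N y)) μ := by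
  refine Integrable.of_bound ((measurable_of_countable (f : ℕ → ℝ)).comp hN).aestronglyMeasurable ‖f‖ ?_
  exact ae_of_all _ fun y => f.norm_coe_le_norm _

lemma cop_pow_apply (P : Measure ℝ) [IsProbabilityMeasure P] (m : ℕ) (N : ℝ → ℕ) (hN : Measurable N)
    (hNm : ∀ y, N y ≤ m) (n : ℕ) (f : BE) (a : ℕ) :
    ((cop shf m (fun k => P.real {y | N y = k}))^n) f a =
      ∫ y, f (a + ∑ j, N (y j)) ∂(Measure.pi fun _ : Fin n => P) := by
  induction n generalizing a with
  | zero => simp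
  | succ n ih =>
    rw [pow_succ', mul_apply_eq_comp, cop_apply P m N hN hNm]
    simp_rw [ih]
    have hmp := measurePreserving_piFinSuccAbove (fun _ : Fin (n+1) => P) 0
    rw [← (hmp.symm).integral_comp' (fun y => f (a + ∑ j, N (y j)))]
    rw [integral_prod]
    · refine integral_congr_ae (ae_of_all _ fun y => ?_)
      refine integral_congr_ae (ae_of_all _ fun z => ?_)
      simp only [Fin.sum_univ_succ]
      simp [add_assoc]
    · exact BE_comp_integrable _ f (fun p => a + ∑ j, N (((MeasurableEquiv.piFinSuccAbove (fun _ => ℝ) 0).symm p) j)) (by fun_prop)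

lemma binom_rev (n : ℕ) (ε : ℝ) (h0 : 0 < ε) (h1 : ε < 1/2) :
    ∑ k ∈ Finset.range (n+1), (n.choose k : ℝ) * ε^k * (1-ε)^(n-k) * (1/√((n-k:ℕ)+1:ℝ))
      ≤ √2/√((n:ℝ)+1) := by
  rw [← Finset.sum_range_reflect]
  have h := binom_inv_sqrt n (1-ε) (by linarith) (by linarith)
  refine le_trans (le_of_eq ?_) (h.trans ?_)
  · refine Finset.sum_congr rfl fun K hK => ?_
    have hK' : K ≤ n := by simpa [Nat.lt_succ_iff] using hK
    rw [show n + 1 - 1 - K = n - K by omega, Nat.choose_symm hK', show n - (n-K) = K by omega]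
    rw [show 1 - (1-ε) = ε by ring]; ring
  · rw [div_le_div_iff₀ (by apply Real.sqrt_pos.2; apply mul_pos <;> [linarith; positivity]) (by positivity), one_mul,
      ← Real.sqrt_mul (by norm_num)]
    apply Real.sqrt_le_sqrt
    have : (0:ℝ) ≤ n := by positivity
    nlinarith

lemma binom_rev' (n : ℕ) (hn : 1 ≤ n) (ε : ℝ) (h0 : 0 < ε) (h1 : ε < 1/2) :
    ∑ k ∈ Finset.range (n+1), (n.choose k : ℝ) * ε^k * (1-ε)^(n-k) * (k * (1/√((n-k:ℕ)+1:ℝ)))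
      ≤ √2 * √n * ε := by
  obtain ⟨n', rfl⟩ : ∃ n', n = n'+1 := ⟨n-1, by omega⟩
  rw [Finset.sum_range_succ']
  have h := binom_rev n' ε h0 h1
  have hs : √((n':ℝ)+1) * √((n':ℝ)+1) = n'+1 := Real.mul_self_sqrt (by positivity)
  have hs0 : 0 < √((n':ℝ)+1) := by positivity
  calc _ = ((n':ℝ)+1) * ε * ∑ k ∈ Finset.range (n'+1), (n'.choose k : ℝ) * ε^k * (1-ε)^(n'-k) * (1/√((n'-k:ℕ)+1:ℝ)) := by
        rw [Finset.mul_sum]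
        simp only [Nat.cast_zero, zero_mul, mul_zero, add_zero]
        refine Finset.sum_congr rfl fun k _ => ?_
        have h' : ((n':ℝ)+1) * n'.choose k = (n'+1).choose (k+1) * ((k:ℝ)+1) := by
          exact_mod_cast Nat.add_one_mul_choose_eq n' k
        rw [Nat.add_sub_add_right]
        push_cast
        calc _ = ((n'+1).choose (k+1) * ((k:ℝ)+1)) * ε^(k+1) * (1-ε)^(n'-k) * (1/√((n'-k:ℕ)+1:ℝ)) := by ring
          _ = _ := by rw [← h']; ring
    _ ≤ ((n':ℝ)+1) * ε * (√2/√((n':ℝ)+1)) := by gcongr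
    _ = _ := by
        push_cast
        rw [mul_div_assoc', div_eq_iff hs0.ne']
        linear_combination (-(ε * √2)) * hs

lemma gen_expand {A : Type} [NormedRing A] [NormedAlgebra ℝ A] (T1 T0 : A) (hcomm : Commute T1 T0) (ε : ℝ) (n : ℕ) :
    (ε • T1 + (1-ε) • T0)^n = ∑ k ∈ Finset.range (n+1),
      ((n.choose k : ℝ) * ε^k * (1-ε)^(n-k)) • (T1^k * T0^(n-k)) := by
  have hcomm' : Commute (ε • T1) ((1-ε) • T0) := (hcomm.smul_left _).smul_right _
  rw [hcomm'.add_pow]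
  refine Finset.sum_congr rfl fun k _ => ?_
  rw [smul_pow, smul_pow, smul_mul_smul_comm, ← Nat.cast_comm, ← nsmul_eq_mul,
      ← Nat.cast_smul_eq_nsmul ℝ, smul_smul]
  rw [mul_assoc]

lemma gen_expand0 {A : Type} [NormedRing A] [NormedAlgebra ℝ A] (T0 : A) (ε : ℝ) (n : ℕ) :
    T0^n = ∑ k ∈ Finset.range (n+1),
      ((n.choose k : ℝ) * ε^k * (1-ε)^(n-k)) • (T0^k * T0^(n-k)) := by
  have := gen_expand T0 T0 (Commute.refl _) ε n
  rwa [← add_smul, add_sub_cancel, one_smul] at this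

lemma gen_mix {A : Type} [NormedRing A] [NormedAlgebra ℝ A] (τ : A) (m : ℕ) (w0 w1 w : ℕ → ℝ) (ε : ℝ)
    (h : ∀ k, w k = (1-ε) * w0 k + ε * w1 k) : cop τ m w = ε • cop τ m w1 + (1-ε) • cop τ m w0 := by
  simp only [cop, h]
  rw [Finset.smul_sum, Finset.smul_sum, ← Finset.sum_add_distrib]
  refine Finset.sum_congr rfl fun k _ => ?_
  rw [smul_smul, smul_smul, ← add_smul, add_comm]

lemma gen_comm {A : Type} [NormedRing A] [NormedAlgebra ℝ A] (τ : A) (m : ℕ) (w0 : ℕ → ℝ) (M d : ℕ) :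
    (cop τ m w0)^M * (1 - τ^d) = (1 - τ^d) * (cop τ m w0)^M :=
  (((Commute.one_right _).sub_right (cop_commute_t τ _ _ d)).pow_left _).eq

lemma BE_abs_le (g : BE) (a : ℕ) : |g a| ≤ ‖g‖ := by
  rw [← Real.norm_eq_abs]; exact BoundedContinuousFunction.norm_coe_le_norm g a

lemma opsum (s : Finset ℕ) (p : ℕ → ℝ) (T : ℕ → (BE →L[ℝ] BE)) (f : BE) :
    (∑ k ∈ s, p k • T k) f 0 = ∑ k ∈ s, p k * (T k f 0) := by
  classical
  induction s using Finset.induction_on with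
  | empty => rfl
  | insert a s ha ih => rw [Finset.sum_insert ha, Finset.sum_insert ha, ← ih]; rfl

lemma tv_fixed (P Q : Measure ℝ) [IsProbabilityMeasure P] [IsProbabilityMeasure Q] (m : ℕ)
    (N0 N1 : ℝ → ℕ) (hN0 : Measurable N0) (hN1 : Measurable N1) (hm0 : ∀ y, N0 y ≤ m)
    (hm1 : ∀ y, N1 y ≤ m) (hle : ∀ y, N0 y ≤ N1 y) (ε : ℝ) (hε0 : 0 < ε) (hε1 : ε < 1/2)
    (hQ : ∀ k, Q.real {y | N0 y = k} = (1-ε) * P.real {y | N0 y = k} + ε * P.real {y | N1 y = k})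
    (c : ℝ) (hc : 0 < c) (s0 : ℕ) (hs0 : 0 < s0)
    (hsm : ∀ M : ℕ, ∀ s ≤ s0,
      ‖(cop shf m (fun k => P.real {y | N0 y = k}))^M * (1 - shf^s)‖ ≤ 2 / √(c * (M+1)))
    (f : BE) (hf : ‖f‖ ≤ 1) (n : ℕ) (hn : 1 ≤ n) :
    |∫ y, f (∑ j, N0 (y j)) ∂(Measure.pi fun _ : Fin n => Q) -
      ∫ y, f (∑ j, N0 (y j)) ∂(Measure.pi fun _ : Fin n => P)| ≤
     2/√c * (√2 * √n * ε * ((∫ y, ((N1 y : ℝ) - N0 y) ∂P)) / s0 + √2/√((n:ℝ)+1)) := by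
  set e := ∫ y, ((N1 y : ℝ) - N0 y) ∂P with he
  set T0 := cop shf m (fun k => P.real {y | N0 y = k}) with hT0
  set T1 := cop shf m (fun k => P.real {y | N1 y = k}) with hT1
  have hTQ : cop shf m (fun k => Q.real {y | N0 y = k}) = ε • T1 + (1-ε) • T0 :=
    gen_mix shf m _ _ _ ε hQ
  have hcomm : Commute T1 T0 := cop_commute shf _ _ _ _
  have h1 := cop_pow_apply Q m N0 hN0 hm0 n f 0
  have h2 := cop_pow_apply P m N0 hN0 hm0 n f 0
  simp only [zero_add] at h1 h2
  rw [← h1, ← h2, hTQ]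
  set p : ℕ → ℝ := fun k => (n.choose k : ℝ) * ε^k * (1-ε)^(n-k) with hp
  have hp0 : ∀ k, 0 ≤ p k := fun k => by
    have : 0 ≤ 1 - ε := by linarith
    positivity
  have hp1 : ∑ k ∈ Finset.range (n+1), p k = 1 := by
    have := add_pow ε (1-ε) n
    rw [add_sub_cancel, one_pow] at this
    rw [this]; refine Finset.sum_congr rfl fun K _ => ?_
    simp only [hp]; ring
  have hL : (ε • T1 + (1-ε) • T0)^n = ∑ k ∈ Finset.range (n+1), p k • (T1^k * T0^(n-k)) :=
    gen_expand T1 T0 hcomm ε n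
  have hR : T0^n = ∑ k ∈ Finset.range (n+1), p k • (T0^k * T0^(n-k)) := gen_expand0 T0 ε n
  have hdiff : ((ε • T1 + (1-ε) • T0)^n) f 0 - (T0^n) f 0 = ∑ k ∈ Finset.range (n+1),
      p k * ((T1^k) ((T0^(n-k)) f) 0 - (T0^k) ((T0^(n-k)) f) 0) := by
    rw [hL]
    conv_lhs => rw [hR]
    rw [opsum, opsum, ← Finset.sum_sub_distrib]
    refine Finset.sum_congr rfl fun k _ => ?_
    rw [mul_sub]; rfl
  rw [hdiff]
  have hbnd : ∀ (N : ℝ → ℕ), Measurable N → (∀ y, N y ≤ m) → Integrable (fun y => (N y : ℝ)) P := by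
    intro N hN hb
    refine Integrable.of_bound ((measurable_of_countable (Nat.cast : ℕ → ℝ)).comp hN).aestronglyMeasurable m ?_
    refine ae_of_all _ fun y => ?_
    simp only [Real.norm_natCast]; exact_mod_cast hb y
  have hint : Integrable (fun y => (N1 y : ℝ) - N0 y) P := (hbnd N1 hN1 hm1).sub (hbnd N0 hN0 hm0)
  have hterm : ∀ k ∈ Finset.range (n+1),
      |(T1^k) ((T0^(n-k)) f) 0 - (T0^k) ((T0^(n-k)) f) 0| ≤
        (k * e / s0 + 1) * (2 / √(c * ((n-k:ℕ)+1:ℝ))) := by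
    intro k _
    set g := (T0^(n-k)) f with hg
    have a1 := cop_pow_apply P m N1 hN1 hm1 k g 0
    have a0 := cop_pow_apply P m N0 hN0 hm0 k g 0
    simp only [zero_add] at a1 a0
    rw [a1, a0, ← integral_sub]
    rotate_left
    · exact BE_comp_integrable _ g _ (by fun_prop)
    · exact BE_comp_integrable _ g _ (by fun_prop)
    set b := 2 / √(c * ((n-k:ℕ)+1:ℝ)) with hb
    have hpt : ∀ y : Fin k → ℝ, |g (∑ j, N1 (y j)) - g (∑ j, N0 (y j))| ≤
        ((∑ j, ((N1 (y j) : ℝ) - N0 (y j))) / s0 + 1) * b := by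
      intro y
      set a := ∑ j, N0 (y j)
      set d := ∑ j, (N1 (y j) - N0 (y j)) with hd
      have hsum : ∑ j, N1 (y j) = a + d := by
        rw [hd, ← Finset.sum_add_distrib]
        exact Finset.sum_congr rfl fun j _ => (Nat.add_sub_cancel' (hle _)).symm
      have hdc : (d:ℝ) = ∑ j, ((N1 (y j) : ℝ) - N0 (y j)) := by
        rw [hd]; push_cast
        exact Finset.sum_congr rfl fun j _ => Nat.cast_sub (hle _)
      rw [hsum, ← hdc]
      have hh := cop_smooth' one_norm shf shf_norm m (fun k => P.real {y | N0 y = k}) b (n-k) s0 hs0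
        (fun s hs => hsm (n-k) s hs) d
      have e1 : (T0^(n-k) * (1 - shf^d)) = (1 - shf^d) * T0^(n-k) :=
        gen_comm shf m _ _ _
      have e2 : ((T0^(n-k) * (1 - shf^d)) f) a = g a - g (a+d) := by
        rw [e1, mul_apply_eq_comp, ← hg, sub_apply, BoundedContinuousFunction.coe_sub, Pi.sub_apply,
          shf_pow_apply]; rfl
      rw [abs_sub_comm, ← e2]
      calc |((T0^(n-k) * (1 - shf^d)) f) a| ≤ ‖(T0^(n-k) * (1 - shf^d)) f‖ :=
            BE_abs_le _ _
        _ ≤ ‖(T0^(n-k) * (1 - shf^d))‖ * ‖f‖ := ContinuousLinearMap.le_opNorm _ _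
        _ ≤ ‖(T0^(n-k) * (1 - shf^d))‖ := mul_le_of_le_one_right (ContinuousLinearMap.opNorm_nonneg _) hf
        _ ≤ _ := hh
    have hintj : ∀ j : Fin k, Integrable (fun y : Fin k → ℝ => ((N1 (y j) : ℝ) - N0 (y j)))
        (Measure.pi fun _ : Fin k => P) := fun j =>
      (measurePreserving_eval (fun _ : Fin k => P) j).integrable_comp_of_integrable hint
    have hintval : ∀ j : Fin k, ∫ y : Fin k → ℝ, ((N1 (y j) : ℝ) - N0 (y j)) ∂(Measure.pi fun _ : Fin k => P) = e := by
      intro j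
      have hmp := measurePreserving_eval (fun _ : Fin k => P) j
      have := integral_map (μ := Measure.pi fun _ : Fin k => P) hmp.measurable.aemeasurable
        (f := fun y => (N1 y : ℝ) - N0 y) (by rw [hmp.map_eq]; exact hint.aestronglyMeasurable)
      rw [hmp.map_eq] at this
      exact this.symm
    have hI : Integrable (fun y : Fin k → ℝ => ((∑ j, ((N1 (y j) : ℝ) - N0 (y j))) / s0 + 1) * b)
        (Measure.pi fun _ : Fin k => P) :=
      (((integrable_finsetSum _ fun j _ => hintj j).div_const _).add (integrable_const _)).mul_const _
    refine (abs_integral_le_integral_abs).trans ((integral_mono_of_nonneg (ae_of_all _ fun _ => abs_nonneg _) hI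
      (ae_of_all _ hpt)).trans (le_of_eq ?_))
    rw [integral_mul_const, integral_add ((integrable_finsetSum _ fun j _ => hintj j).div_const _) (integrable_const _),
      integral_div, integral_finsetSum _ fun j _ => hintj j]
    simp [hintval]
  have he0 : 0 ≤ e := by
    refine integral_nonneg fun y => ?_
    have : (N0 y : ℝ) ≤ N1 y := by exact_mod_cast hle y
    exact sub_nonneg.2 this
  calc _ ≤ ∑ k ∈ Finset.range (n+1), p k * ((k * e / s0 + 1) * (2 / √(c * ((n-k:ℕ)+1:ℝ)))) := by
        refine (Finset.abs_sum_le_sum_abs _ _).trans (Finset.sum_le_sum fun k hk => ?_)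
        rw [abs_mul, abs_of_nonneg (hp0 k)]
        exact mul_le_mul_of_nonneg_left (hterm k hk) (hp0 k)
    _ = 2/√c * ((∑ k ∈ Finset.range (n+1), p k * (k * (1/√((n-k:ℕ)+1:ℝ)))) * (e/s0) +
          ∑ k ∈ Finset.range (n+1), p k * (1/√((n-k:ℕ)+1:ℝ))) := by
        rw [Finset.sum_mul, ← Finset.sum_add_distrib, Finset.mul_sum]
        refine Finset.sum_congr rfl fun k _ => ?_
        rw [Real.sqrt_mul hc.le]
        have : √c ≠ 0 := by positivity
        have : √((n-k:ℕ)+1:ℝ) ≠ 0 := by positivity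
        field_simp
    _ ≤ 2/√c * ((√2 * √n * ε) * (e/s0) + √2/√((n:ℝ)+1)) := by
        gcongr
        · exact binom_rev' n hn ε hε0 hε1
        · exact binom_rev n ε hε0 hε1
    _ = _ := by ring

lemma F_eq_cdf (P : Measure ℝ) [IsProbabilityMeasure P]
    (F : ℝ → ℝ) (hF : ∀ t, F t = (P (Set.Iic t)).toReal) : F = fun t => cdf P t := by
  ext t; rw [cdf_eq_real, hF]; rfl

lemma F_mono (P : Measure ℝ) [IsProbabilityMeasure P]
    (F : ℝ → ℝ) (hF : ∀ t, F t = (P (Set.Iic t)).toReal) : Monotone F := by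
  rw [F_eq_cdf P F hF]; exact monotone_cdf P

lemma F_nonneg (P : Measure ℝ) [IsProbabilityMeasure P]
    (F : ℝ → ℝ) (hF : ∀ t, F t = (P (Set.Iic t)).toReal) (t) : 0 ≤ F t := by
  rw [F_eq_cdf P F hF]; exact cdf_nonneg P t

lemma F_le_one (P : Measure ℝ) [IsProbabilityMeasure P]
    (F : ℝ → ℝ) (hF : ∀ t, F t = (P (Set.Iic t)).toReal) (t) : F t ≤ 1 := by
  rw [F_eq_cdf P F hF]; exact cdf_le_one P t

lemma F_surj (P : Measure ℝ) [IsProbabilityMeasure P]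
    (F : ℝ → ℝ) (hF : ∀ t, F t = (P (Set.Iic t)).toReal) (hFcont : Continuous F)
    (u : ℝ) (h0 : 0 < u) (h1 : u < 1) : ∃ t, F t = u := by
  have a := tendsto_cdf_atBot P
  have b := tendsto_cdf_atTop P
  have e := F_eq_cdf P F hF
  rw [show (⇑(cdf P)) = F from e.symm] at a b
  have ha := (a.eventually (gt_mem_nhds h0)).exists
  have hb := (b.eventually (lt_mem_nhds h1)).exists
  obtain ⟨s, hs⟩ := ha
  obtain ⟨r, hr⟩ := hb
  exact mem_range_of_exists_le_of_exists_ge hFcont ⟨s, hs.le⟩ ⟨r, hr.le⟩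

lemma F_lt (P : Measure ℝ) [IsProbabilityMeasure P]
    (F : ℝ → ℝ) (hF : ∀ t, F t = (P (Set.Iic t)).toReal) (hFcont : Continuous F)
    (u : ℝ) (h0 : 0 < u) : P.real {y | F y < u} ≤ u := by
  rcases lt_or_ge u 1 with h1 | h1
  · obtain ⟨t, ht⟩ := F_surj P F hF hFcont u h0 h1
    calc P.real {y | F y < u} ≤ P.real (Iic t) := by
          refine measureReal_mono ?_
          intro y hy
          by_contra hc
          have := F_mono P F hF (not_le.1 hc).le
          simp only [mem_ofPred_eq] at hy; linarith
      _ = u := by rw [← ht, hF]; rfl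
  · exact measureReal_le_one.trans h1

lemma F_le (P : Measure ℝ) [IsProbabilityMeasure P]
    (F : ℝ → ℝ) (hF : ∀ t, F t = (P (Set.Iic t)).toReal) (hFcont : Continuous F)
    (u : ℝ) (h0 : 0 ≤ u) (h1 : u ≤ 1) : P.real {y | F y ≤ u} = u := by
  apply le_antisymm
  · apply le_of_forall_gt_imp_ge_of_dense
    intro u' hu'
    refine le_trans (measureReal_mono ?_) (F_lt P F hF hFcont u' (by linarith))
    intro y hy; exact lt_of_le_of_lt hy hu'
  · rcases h0.eq_or_lt with rfl | h0
    · positivity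
    rcases h1.eq_or_lt with rfl | h1
    · have : {y | F y ≤ 1} = univ := by ext y; simp [F_le_one P F hF]
      rw [this]; simp
    obtain ⟨t, ht⟩ := F_surj P F hF hFcont u h0 h1
    calc u = P.real (Iic t) := by rw [← ht, hF]; rfl
      _ ≤ _ := by
          refine measureReal_mono ?_
          intro y hy
          exact (F_mono P F hF hy).trans ht.le

lemma F_map (P : Measure ℝ) [IsProbabilityMeasure P]
    (F : ℝ → ℝ) (hF : ∀ t, F t = (P (Set.Iic t)).toReal) (hFcont : Continuous F) :
    P.map F = volume.restrict (Icc 0 1) := by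
  have : IsProbabilityMeasure (P.map F) := Measure.isProbabilityMeasure_map hFcont.aemeasurable
  apply Measure.ext_of_Iic
  intro a
  rw [Measure.map_apply hFcont.measurable measurableSet_Iic, Measure.restrict_apply measurableSet_Iic]
  rcases lt_or_ge a 0 with h | h
  · have e1 : F ⁻¹' Iic a = ∅ := by
      ext y; simp; exact lt_of_lt_of_le h (F_nonneg P F hF y)
    have e2 : Iic a ∩ Icc 0 1 = ∅ := by
      ext y; simp; intro h1 h2; linarith
    rw [e1, e2]; simp
  rcases le_or_gt a 1 with h' | h'
  · have e2 : Iic a ∩ Icc 0 1 = Icc 0 a := by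
      ext y; simp only [mem_inter_iff, mem_Iic, mem_Icc]
      constructor
      · rintro ⟨h1, h2, h3⟩; exact ⟨h2, h1⟩
      · rintro ⟨h1, h2⟩; exact ⟨h2, h1, by linarith⟩
    rw [e2, Real.volume_Icc, sub_zero, ← F_le P F hF hFcont a h h', Measure.real, ENNReal.ofReal_toReal (measure_ne_top _ _)]
    rw [← Measure.real, F_le P F hF hFcont a h h']; rfl
  · have e1 : F ⁻¹' Iic a = univ := by
      ext y; simp; exact (F_le_one P F hF y).trans h'.le
    have e2 : Iic a ∩ Icc 0 1 = Icc 0 1 := by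
      ext y; simp only [mem_inter_iff, mem_Iic, mem_Icc, and_iff_right_iff_imp]; intro h; linarith [h.2]
    rw [e1, e2]; simp

lemma F_integral (P : Measure ℝ) [IsProbabilityMeasure P]
    (F : ℝ → ℝ) (hF : ∀ t, F t = (P (Set.Iic t)).toReal) (hFcont : Continuous F)
    (g : ℝ → ℝ) (hg : Continuous g) : ∫ y, g (F y) ∂P = ∫ u in (0:ℝ)..1, g u := by
  rw [← integral_map (φ := F) (f := g) hFcont.aemeasurable hg.aestronglyMeasurable, F_map P F hF hFcont,
    intervalIntegral.integral_of_le zero_le_one, integral_Icc_eq_integral_Ioc]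

lemma F_mean (P : Measure ℝ) [IsProbabilityMeasure P]
    (F : ℝ → ℝ) (hF : ∀ t, F t = (P (Set.Iic t)).toReal) (hFcont : Continuous F) :
    ∫ y, F y ∂P = 1/2 := by
  rw [F_integral P F hF hFcont (fun u => u) continuous_id]; simp

lemma F_var (P : Measure ℝ) [IsProbabilityMeasure P]
    (F : ℝ → ℝ) (hF : ∀ t, F t = (P (Set.Iic t)).toReal) (hFcont : Continuous F) :
    ∫ y, (F y - 1/2)^2 ∂P = 1/12 := by
  rw [F_integral P F hF hFcont (fun u => (u-1/2)^2) (by fun_prop)]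
  rw [intervalIntegral.integral_comp_sub_right (fun u => u^2)]; simp; norm_num

lemma F_near (P : Measure ℝ) [IsProbabilityMeasure P]
    (F : ℝ → ℝ) (hF : ∀ t, F t = (P (Set.Iic t)).toReal) (hFcont : Continuous F) (a t : ℝ) (ht : 0 ≤ t) :
    P.real {y | |F y - a| < t} ≤ 2 * t := by
  have : P {y | |F y - a| < t} ≤ ENNReal.ofReal (2*t) := by
    have e : {y | |F y - a| < t} = F ⁻¹' (Ioo (a-t) (a+t)) := by
      ext y; simp only [mem_ofPred_eq, mem_preimage, mem_Ioo, abs_lt]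
      constructor <;> rintro ⟨h1, h2⟩ <;> constructor <;> linarith
    rw [e, ← Measure.map_apply hFcont.measurable measurableSet_Ioo, F_map P F hF hFcont]
    refine (Measure.restrict_apply_le _ _).trans ?_
    rw [Real.volume_Ioo]; apply ENNReal.ofReal_le_ofReal; linarith
  exact ENNReal.toReal_le_of_le_ofReal (by positivity) this

lemma P_Iio (P : Measure ℝ) [IsProbabilityMeasure P]
    (F : ℝ → ℝ) (hF : ∀ t, F t = (P (Set.Iic t)).toReal) (hFcont : Continuous F) (t : ℝ) :
    P.real (Iio t) = F t := by
  rw [hF]; 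
  apply le_antisymm
  · exact measureReal_mono Iio_subset_Iic_self
  · rw [← hF]
    have h1 : Tendsto F (𝓝[<] t) (𝓝 (F t)) := (hFcont.tendsto t).mono_left nhdsWithin_le_nhds
    refine le_of_tendsto h1 ?_
    filter_upwards [self_mem_nhdsWithin] with s hs
    rw [hF]
    exact measureReal_mono (Iic_subset_Iio.2 hs)

noncomputable def Ncnt {m : ℕ} (x : Fin m → ℝ) (y : ℝ) : ℕ :=
  (Finset.univ.filter fun i : Fin m => x i < y).card

lemma Ustat_eq {m n : ℕ} (x : Fin m → ℝ) (y : Fin n → ℝ) : Ustat x y = ∑ j, Ncnt x (y j) := by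
  unfold Ustat Ncnt
  simp only [Finset.card_filter]
  rw [Finset.sum_product_right]

lemma Ncnt_le {m : ℕ} (x : Fin m → ℝ) (y : ℝ) : Ncnt x y ≤ m := by
  refine (Finset.card_le_univ _).trans ?_
  simp

lemma Ncnt_mono {m : ℕ} (x : Fin m → ℝ) : Monotone (Ncnt x) := by
  intro a b hab
  refine Finset.card_le_card ?_
  intro i
  simp only [Finset.mem_filter, Finset.mem_univ, true_and]
  intro h; linarith

lemma Ncnt_lt {m : ℕ} (x : Fin m → ℝ) (i : Fin m) (y : ℝ) (h : x i < y) : Ncnt x (x i) < Ncnt x y := by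
  refine Finset.card_lt_card ?_
  rw [Finset.ssubset_iff_of_subset]
  · exact ⟨i, by simp [h], by simp⟩
  · intro i
    simp only [Finset.mem_filter, Finset.mem_univ, true_and]
    intro h; linarith

lemma Ncnt_lt_m {m : ℕ} (x : Fin m → ℝ) (i : Fin m) : Ncnt x (x i) < m :=
  (Ncnt_lt x i (x i + 1) (by linarith)).trans_le (Ncnt_le _ _)

lemma Ncnt_surj {m : ℕ} (x : Fin m → ℝ) (hx : Function.Injective x) (k : ℕ) (hk : k < m) :
    ∃ i, Ncnt x (x i) = k := by
  let r : Fin m → Fin m := fun i => ⟨Ncnt x (x i), Ncnt_lt_m x i⟩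
  have hr : Function.Injective r := by
    intro i j hij
    have h : Ncnt x (x i) = Ncnt x (x j) := by simpa [r] using hij
    rcases lt_trichotomy (x i) (x j) with h' | h' | h'
    · have := Ncnt_lt x i _ h'; omega
    · exact hx h'
    · have := Ncnt_lt x j _ h'; omega
  obtain ⟨i, hi⟩ := (Finite.injective_iff_surjective.1 hr) ⟨k, hk⟩
  exact ⟨i, by simpa [r] using hi⟩

noncomputable def pcnt {m : ℕ} (F : ℝ → ℝ) (δ : ℝ) (x : Fin m → ℝ) : ℕ :=
  (Finset.univ.filter fun p : Fin m × Fin m => p.1 ≠ p.2 ∧ |F (x p.1) - F (x p.2)| < δ).card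

lemma bad_cells (P : Measure ℝ) [IsProbabilityMeasure P]
    (F : ℝ → ℝ) (hF : ∀ t, F t = (P (Set.Iic t)).toReal) {m : ℕ} (x : Fin m → ℝ)
    (hx : Function.Injective x) (δ : ℝ) :
    ((Finset.range (m+1)).filter (fun k => P.real {y | Ncnt x y = k} < δ)).card ≤ 2 + pcnt F δ x := by
  classical
  have hsub : (Finset.range (m+1)).filter (fun k => P.real {y | Ncnt x y = k} < δ) ⊆
      {0, m} ∪ (Finset.univ.filter fun p : Fin m × Fin m => p.1 ≠ p.2 ∧ |F (x p.1) - F (x p.2)| < δ).image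
        (fun p => Ncnt x (x p.2)) := by
    intro k hk
    simp only [Finset.mem_filter, Finset.mem_range] at hk
    obtain ⟨hk1, hk2⟩ := hk
    by_cases h0 : k = 0
    · simp [h0]
    by_cases hm : k = m
    · simp [hm]
    apply Finset.mem_union_right
    obtain ⟨i, hi⟩ := Ncnt_surj x hx (k-1) (by omega)
    obtain ⟨i', hi'⟩ := Ncnt_surj x hx k (by omega)
    rw [Finset.mem_image]
    refine ⟨(i, i'), ?_, hi'⟩
    have hlt : x i < x i' := by
      by_contra hc
      have := Ncnt_mono x (not_lt.1 hc); omega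
    simp only [Finset.mem_filter, Finset.mem_univ, true_and]
    refine ⟨fun h => by rw [h] at hlt; exact lt_irrefl _ hlt, ?_⟩
    refine lt_of_le_of_lt ?_ hk2
    have hm := F_mono P F hF hlt.le
    rw [abs_sub_comm, abs_of_nonneg (by linarith)]
    have hs : Ioc (x i) (x i') ⊆ {y | Ncnt x y = k} := by
      intro y hy
      have h1 := Ncnt_lt x i y hy.1
      have h2 := Ncnt_mono x hy.2
      show Ncnt x y = k
      omega
    refine le_trans (le_of_eq ?_) (measureReal_mono hs)
    rw [← Iic_sdiff_Iic, measureReal_sdiff (Iic_subset_Iic.2 hlt.le) measurableSet_Iic, hF, hF]; rfl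
  refine (Finset.card_le_card hsub).trans ((Finset.card_union_le _ _).trans ?_)
  exact Nat.add_le_add Finset.card_le_two Finset.card_image_le

lemma pair_map (P : Measure ℝ) [IsProbabilityMeasure P] {m : ℕ} (i j : Fin m) (hij : i ≠ j) :
    (Measure.pi (fun _ : Fin m => P)).map (fun x => (x i, x j)) = P.prod P := by
  have h := iIndepFun_pi (μ := fun _ : Fin m => P) (X := fun _ => (id : ℝ → ℝ)) (fun i => aemeasurable_id)
  have h2 : IndepFun (fun x : Fin m → ℝ => x i) (fun x => x j) (Measure.pi fun _ : Fin m => P) := h.indepFun hij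
  rw [indepFun_iff_map_prod_eq_prod_map_map (measurable_pi_apply i).aemeasurable (measurable_pi_apply j).aemeasurable] at h2
  have e : ∀ k : Fin m, (Measure.pi (fun _ : Fin m => P)).map (fun x => x k) = P :=
    fun k => (measurePreserving_eval (fun _ : Fin m => P) k).map_eq
  rw [e, e] at h2
  exact h2

lemma pair_near (P : Measure ℝ) [IsProbabilityMeasure P]
    (F : ℝ → ℝ) (hF : ∀ t, F t = (P (Set.Iic t)).toReal) (hFcont : Continuous F) {m : ℕ} (i j : Fin m) (hij : i ≠ j)
    (δ : ℝ) (hδ : 0 ≤ δ) :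
    (Measure.pi (fun _ : Fin m => P)).real {x | |F (x i) - F (x j)| < δ} ≤ 2 * δ := by
  have hms : MeasurableSet {p : ℝ × ℝ | |F p.1 - F p.2| < δ} :=
    measurableSet_lt (by fun_prop) (by fun_prop)
  have e : (Measure.pi (fun _ : Fin m => P)) {x | |F (x i) - F (x j)| < δ} = (P.prod P) {p : ℝ × ℝ | |F p.1 - F p.2| < δ} := by
    rw [← pair_map P i j hij, Measure.map_apply (by fun_prop) hms]; rfl
  rw [Measure.real, e]
  refine ENNReal.toReal_le_of_le_ofReal (by positivity) ?_
  rw [Measure.prod_apply_symm hms]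
  calc _ ≤ ∫⁻ y, ENNReal.ofReal (2*δ) ∂P := by
        refine lintegral_mono fun y => ?_
        have := F_near P F hF hFcont (F y) δ hδ
        rw [← ENNReal.ofReal_toReal (measure_ne_top P ((fun x => (x, y)) ⁻¹' _))]
        exact ENNReal.ofReal_le_ofReal this
    _ = _ := by simp

lemma pcnt_int (P : Measure ℝ) [IsProbabilityMeasure P]
    (F : ℝ → ℝ) (hF : ∀ t, F t = (P (Set.Iic t)).toReal) (hFcont : Continuous F) (m : ℕ) (δ : ℝ) (hδ : 0 ≤ δ) :
    Integrable (fun x : Fin m → ℝ => (pcnt F δ x : ℝ)) (Measure.pi (fun _ : Fin m => P)) ∧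
    ∫ x : Fin m → ℝ, (pcnt F δ x : ℝ) ∂(Measure.pi (fun _ : Fin m => P)) ≤ (m:ℝ)^2 * (2 * δ) := by
  have e : ∀ x : Fin m → ℝ, (pcnt F δ x : ℝ) = ∑ p : Fin m × Fin m, if p.1 ≠ p.2 then
      ({x : Fin m → ℝ | |F (x p.1) - F (x p.2)| < δ}.indicator (fun _ => (1:ℝ)) x) else 0 := by
    intro x
    simp only [pcnt, Finset.card_filter, Nat.cast_sum]
    refine Finset.sum_congr rfl fun p _ => ?_
    by_cases h1 : p.1 = p.2 <;> simp [h1, indicator_apply]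
  have hms : ∀ p : Fin m × Fin m, MeasurableSet {x : Fin m → ℝ | |F (x p.1) - F (x p.2)| < δ} := fun p =>
    measurableSet_lt (by fun_prop) (by fun_prop)
  have hi : ∀ p : Fin m × Fin m, Integrable (fun x => if p.1 ≠ p.2 then
      ({x : Fin m → ℝ | |F (x p.1) - F (x p.2)| < δ}.indicator (fun _ => (1:ℝ)) x) else 0) (Measure.pi (fun _ : Fin m => P)) := by
    intro p
    split_ifs
    · exact (integrable_const _).indicator (hms p)
    · exact integrable_const _
  simp only [e]
  refine ⟨integrable_finsetSum _ fun p _ => hi p, ?_⟩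
  rw [integral_finsetSum _ fun p _ => hi p]
  calc _ ≤ ∑ p : Fin m × Fin m, 2 * δ := by
        refine Finset.sum_le_sum fun p _ => ?_
        split_ifs with h
        · rw [integral_indicator (hms p)]
          simp only [integral_const, MeasurableSet.univ, smul_eq_mul, mul_one, measureReal_restrict_apply, univ_inter]
          exact pair_near P F hF hFcont _ _ h δ hδ
        · simp; exact hδ
    _ = _ := by
        rw [Finset.sum_const, Finset.card_univ, Fintype.card_prod, Fintype.card_fin, nsmul_eq_mul]
        push_cast; ring

lemma ae_inj (P : Measure ℝ) [IsProbabilityMeasure P]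
    (F : ℝ → ℝ) (hF : ∀ t, F t = (P (Set.Iic t)).toReal) (hFcont : Continuous F) (m : ℕ) :
    ∀ᵐ x ∂(Measure.pi (fun _ : Fin m => P)), Function.Injective x := by
  have : ∀ i j : Fin m, ∀ᵐ x ∂(Measure.pi (fun _ : Fin m => P)), i ≠ j → x i ≠ x j := by
    intro i j
    by_cases h : i = j
    · exact ae_of_all _ fun x hx => absurd h hx
    have h0 : (Measure.pi (fun _ : Fin m => P)).real {x | x i = x j} = 0 := by
      apply le_antisymm _ (by positivity)
      apply le_of_forall_pos_le_add
      intro t ht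
      calc _ ≤ (Measure.pi (fun _ : Fin m => P)).real {x | |F (x i) - F (x j)| < t/2} := by
            refine measureReal_mono ?_
            intro x hx
            simp only [mem_ofPred_eq] at hx ⊢
            rw [hx]; simpa using ht
        _ ≤ _ := (pair_near P F hF hFcont i j h (t/2) (by positivity)).trans (by linarith)
    rw [measureReal_eq_zero_iff] at h0
    rw [ae_iff]
    refine measure_mono_null ?_ h0
    intro x hx
    simpa [h] using hx
  have h2 := ae_all_iff.2 fun i => ae_all_iff.2 (this i)
  filter_upwards [h2] with x hx i j hij
  by_contra hc
  exact hx i j hc hij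

lemma Ncnt_meas {m : ℕ} (x : Fin m → ℝ) : Measurable (Ncnt x) := (Ncnt_mono x).measurable

lemma Ncnt_cast {m : ℕ} (x : Fin m → ℝ) (y : ℝ) : (Ncnt x y : ℝ) = ∑ i, (Ioi (x i)).indicator (fun _ => (1:ℝ)) y := by
  simp only [Ncnt, Finset.card_filter, indicator_apply, mem_Ioi]
  push_cast; rfl

lemma Ncnt_shift_int (P : Measure ℝ) [IsProbabilityMeasure P]
    (F : ℝ → ℝ) (hF : ∀ t, F t = (P (Set.Iic t)).toReal) {m : ℕ} (x : Fin m → ℝ) (μ : ℝ) :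
    Integrable (fun y => (Ncnt x (y + μ) : ℝ)) P ∧
    ∫ y, (Ncnt x (y + μ) : ℝ) ∂P = ∑ i, (1 - F (x i - μ)) := by
  have e : ∀ y, (Ncnt x (y+μ) : ℝ) = ∑ i, (Ioi (x i - μ)).indicator (fun _ => (1:ℝ)) y := by
    intro y; rw [Ncnt_cast]
    refine Finset.sum_congr rfl fun i _ => ?_
    simp [indicator_apply, sub_lt_iff_lt_add]
  simp only [e]
  have hi : ∀ i, Integrable ((Ioi (x i - μ)).indicator (fun _ => (1:ℝ))) P :=
    fun i => (integrable_const _).indicator measurableSet_Ioi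
  refine ⟨integrable_finsetSum _ fun i _ => hi i, ?_⟩
  rw [integral_finsetSum _ fun i _ => hi i]
  refine Finset.sum_congr rfl fun i _ => ?_
  rw [integral_indicator measurableSet_Ioi]
  simp only [integral_const, MeasurableSet.univ, smul_eq_mul, mul_one, measureReal_restrict_apply, univ_inter]
  rw [← compl_Iic, probReal_compl_eq_one_sub measurableSet_Iic, hF]; rfl

lemma mix_real (P Q : Measure ℝ) [IsProbabilityMeasure P] (ε μ : ℝ) (h0 : 0 < ε) (h1 : ε < 1/2)
    (hQ : Q = ENNReal.ofReal (1 - ε) • P + ENNReal.ofReal ε • P.map (· + μ)) (S : Set ℝ) (hS : MeasurableSet S) :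
    Q.real S = (1-ε) * P.real S + ε * P.real {y | y + μ ∈ S} := by
  rw [hQ]
  simp only [Measure.real, Measure.coe_add, Measure.coe_smul, Pi.add_apply, Pi.smul_apply, smul_eq_mul]
  rw [Measure.map_apply (by fun_prop) hS, ENNReal.toReal_add (by finiteness) (by finiteness), ENNReal.toReal_mul, ENNReal.toReal_mul,
    ENNReal.toReal_ofReal (by linarith), ENNReal.toReal_ofReal (by linarith)]
  rfl

noncomputable def indBE (A : Set ℕ) : BE :=
  BoundedContinuousFunction.ofNormedAddCommGroup (A.indicator fun _ => (1:ℝ)) continuous_of_discreteTopology 1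
    (fun k => by by_cases h : k ∈ A <;> simp [h])

lemma indBE_norm (A : Set ℕ) : ‖indBE A‖ ≤ 1 := BoundedContinuousFunction.norm_ofNormedAddCommGroup_le _ zero_le_one _

lemma indBE_apply (A : Set ℕ) (k : ℕ) : indBE A k = A.indicator (fun _ => (1:ℝ)) k := rfl

lemma Ustat_meas (m n : ℕ) : Measurable (fun ω : (Fin m → ℝ) × (Fin n → ℝ) => Ustat ω.1 ω.2) := by
  classical
  unfold Ustat
  simp only [Finset.card_filter]
  refine Finset.measurable_sum _ fun p _ => ?_
  refine Measurable.ite (measurableSet_lt (by fun_prop) (by fun_prop)) measurable_const measurable_const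

lemma Ustat_prob (P Q : Measure ℝ) [IsProbabilityMeasure P] [IsProbabilityMeasure Q] (m n : ℕ) (A : Set ℕ) :
    Integrable (fun x => ∫ y, indBE A (∑ j, Ncnt x (y j)) ∂(Measure.pi fun _ : Fin n => Q)) (Measure.pi fun _ : Fin m => P) ∧
    ((Measure.pi fun _ : Fin m => P).prod (Measure.pi fun _ : Fin n => Q)).real {ω | Ustat ω.1 ω.2 ∈ A} =
    ∫ x, (∫ y, indBE A (∑ j, Ncnt x (y j)) ∂(Measure.pi fun _ : Fin n => Q)) ∂(Measure.pi fun _ : Fin m => P) := by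
  have hms : MeasurableSet {ω : (Fin m → ℝ) × (Fin n → ℝ) | Ustat ω.1 ω.2 ∈ A} := Ustat_meas m n (MeasurableSet.of_discrete)
  have hI : Integrable ({ω : (Fin m → ℝ) × (Fin n → ℝ) | Ustat ω.1 ω.2 ∈ A}.indicator (fun _ => (1:ℝ)))
    ((Measure.pi fun _ : Fin m => P).prod (Measure.pi fun _ : Fin n => Q)) := (integrable_const _).indicator hms
  have e : ∀ (x : Fin m → ℝ) (y : Fin n → ℝ), indBE A (∑ j, Ncnt x (y j)) =
      ({ω : (Fin m → ℝ) × (Fin n → ℝ) | Ustat ω.1 ω.2 ∈ A}.indicator (fun _ => (1:ℝ))) (x, y) := by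
    intro x y; rw [← Ustat_eq, indBE_apply]; rfl
  simp only [e]
  refine ⟨hI.integral_prod_left, ?_⟩
  rw [← integral_prod _ hI, integral_indicator hms]
  simp

lemma tv_main (P Q : Measure ℝ) [IsProbabilityMeasure P] [IsProbabilityMeasure Q]
    (F : ℝ → ℝ) (hF : ∀ t, F t = (P (Set.Iic t)).toReal) (hFcont : Continuous F)
    (ε μ : ℝ) (h0 : 0 < ε) (h1 : ε < 1/2) (hμ : 0 < μ)
    (hQ : Q = ENNReal.ofReal (1 - ε) • P + ENNReal.ofReal ε • P.map (· + μ))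
    (m n : ℕ) (hm : 32 ≤ m) (hn : 1 ≤ n) (κ : ℝ) (hκ : 0 < κ) (A : Set ℕ) :
    |((Measure.pi fun _ : Fin m => P).prod (Measure.pi fun _ : Fin n => Q)).real {ω | Ustat ω.1 ω.2 ∈ A} -
     ((Measure.pi fun _ : Fin m => P).prod (Measure.pi fun _ : Fin n => P)).real {ω | Ustat ω.1 ω.2 ∈ A}| ≤
    32 * κ + 2/√(κ/2) * (8 * √2 * (√n * ε * (1/2 - ∫ x, F (x - μ) ∂P)) + √2/√((n:ℝ)+1)) := by
  obtain ⟨i1, e1⟩ := Ustat_prob P Q m n A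
  obtain ⟨i0, e0⟩ := Ustat_prob P P m n A
  rw [e1, e0, ← integral_sub i1 i0]
  have hm0 : (0:ℝ) < m := by positivity
  set s0 := m / 4 with hs0
  have hs0m : (m:ℝ) ≤ 8 * s0 := by
    have : m ≤ 8 * s0 := by omega
    exact_mod_cast this
  have hs0p : 0 < s0 := by omega
  have hs0p' : (0:ℝ) < s0 := by positivity
  set E : (Fin m → ℝ) → ℝ := fun x => ∑ i, (F (x i) - F (x i - μ)) with hE
  have hEn : ∀ x, 0 ≤ E x := fun x => Finset.sum_nonneg fun i _ => sub_nonneg.2 (F_mono P F hF (by linarith))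
  have hEx : ∀ x : Fin m → ℝ, ∫ y, ((Ncnt x (y+μ) : ℝ) - Ncnt x y) ∂P = E x := by
    intro x
    have a := Ncnt_shift_int P F hF x μ
    have b := Ncnt_shift_int P F hF x 0
    simp only [add_zero, sub_zero] at b
    rw [integral_sub a.1 b.1, a.2, b.2, ← Finset.sum_sub_distrib]
    refine Finset.sum_congr rfl fun i _ => by ring
  have hpt : ∀ᵐ x ∂(Measure.pi fun _ : Fin m => P),
      |(∫ y, indBE A (∑ j, Ncnt x (y j)) ∂(Measure.pi fun _ : Fin n => Q)) -
        (∫ y, indBE A (∑ j, Ncnt x (y j)) ∂(Measure.pi fun _ : Fin n => P))| ≤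
      16 / m * pcnt F (κ/m) x + 2/√(κ/2) * (√2 * √n * ε * E x / s0 + √2/√((n:ℝ)+1)) := by
    filter_upwards [ae_inj P F hF hFcont m] with x hx
    have hEx0 := hEn x
    by_cases hc : 8 * (2 + pcnt F (κ/m) x) ≤ m
    · have hb := bad_cells P F hF x hx (κ/m)
      have hsum1 : ∑ k ∈ Finset.range (m+1), P.real {y | Ncnt x y = k} = 1 := by
        have := measureReal_biUnion_finset (μ := P) (s := Finset.range (m+1)) (f := fun k => {y | Ncnt x y = k})
          (fun a _ b _ hab => Set.disjoint_left.2 fun y h1 h2 => hab (h1.symm.trans h2))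
          (fun k _ => Ncnt_meas x (measurableSet_singleton k))
        rw [← this]
        have : (⋃ k ∈ Finset.range (m+1), {y | Ncnt x y = k}) = univ := by
          ext y; simp [Ncnt_le]
        rw [this]; simp
      have := tv_fixed P Q m (Ncnt x) (fun y => Ncnt x (y+μ)) (Ncnt_meas x) ((Ncnt_meas x).comp (by fun_prop))
        (Ncnt_le x) (fun y => Ncnt_le x _) (fun y => Ncnt_mono x (by linarith)) ε h0 h1
        (fun k => mix_real P Q ε μ h0 h1 hQ _ (Ncnt_meas x (measurableSet_singleton k)))
        (κ/2) (by positivity) s0 hs0p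
        (fun M s hs => cop_smooth one_norm shf shf_norm m _ (fun k => measureReal_nonneg) hsum1 κ hκ (by omega)
          ((Nat.mul_le_mul_left 8 hb).trans hc) s (by omega) M)
        (indBE A) (indBE_norm A) n hn
      rw [hEx] at this
      refine this.trans ?_
      have : 0 ≤ 16 / (m:ℝ) * pcnt F (κ/m) x := by positivity
      linarith
    · have h01 : ∀ (R : Measure ℝ) [IsProbabilityMeasure R], 0 ≤ (∫ y, indBE A (∑ j, Ncnt x (y j)) ∂(Measure.pi fun _ : Fin n => R)) ∧
          (∫ y, indBE A (∑ j, Ncnt x (y j)) ∂(Measure.pi fun _ : Fin n => R)) ≤ 1 := by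
        intro R _
        constructor
        · refine integral_nonneg fun y => ?_
          rw [indBE_apply]; exact indicator_nonneg (fun _ _ => zero_le_one) _
        · have := integral_mono (μ := Measure.pi fun _ : Fin n => R) (f := fun y => indBE A (∑ j, Ncnt x (y j))) (g := fun _ => (1:ℝ))
            (BE_comp_integrable _ _ _ (by have := Ncnt_meas x; fun_prop)) (integrable_const _) (fun y => by
              simp only [indBE_apply]; exact indicator_le_self' (fun _ _ => zero_le_one) _)
          simpa using this
      have a := h01 P
      have b := h01 Q
      have hcc : (m:ℝ) ≤ 16 * pcnt F (κ/m) x := by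
        have : m ≤ 16 * pcnt F (κ/m) x := by omega
        exact_mod_cast this
      have h2 : 1 ≤ 16 / (m:ℝ) * pcnt F (κ/m) x := by
        rw [div_mul_eq_mul_div, le_div_iff₀ hm0]; linarith
      have h3 : 0 ≤ 2/√(κ/2) * (√2 * √n * ε * E x / s0 + √2/√((n:ℝ)+1)) := by positivity
      rw [abs_le]; constructor <;> linarith [a.1, a.2, b.1, b.2]
  obtain ⟨pi1, pi2⟩ := pcnt_int P F hF hFcont m (κ/m) (by positivity)
  have hFsh : Integrable (fun y => F y - F (y - μ)) P := by
    have hb : ∀ g : ℝ → ℝ, Continuous g → Integrable (fun y => F (g y)) P := fun g hg =>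
      Integrable.of_bound (hFcont.comp hg).aestronglyMeasurable 1 (ae_of_all _ fun y => by
        rw [Real.norm_eq_abs, abs_of_nonneg (F_nonneg P F hF _)]; exact F_le_one P F hF _)
    exact (hb _ continuous_id).sub (hb (fun y => y - μ) (by fun_prop))
  have hFval : ∫ y, (F y - F (y-μ)) ∂P = 1/2 - ∫ x, F (x - μ) ∂P := by
    have hb : ∀ g : ℝ → ℝ, Continuous g → Integrable (fun y => F (g y)) P := fun g hg =>
      Integrable.of_bound (hFcont.comp hg).aestronglyMeasurable 1 (ae_of_all _ fun y => by
        rw [Real.norm_eq_abs, abs_of_nonneg (F_nonneg P F hF _)]; exact F_le_one P F hF _)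
    rw [integral_sub (hb (fun y => y) continuous_id) (hb (fun y => y - μ) (by fun_prop))]
    rw [F_mean P F hF hFcont]
  have hEint : ∀ i : Fin m, Integrable (fun x : Fin m → ℝ => F (x i) - F (x i - μ)) (Measure.pi fun _ : Fin m => P) := fun i =>
    (measurePreserving_eval (fun _ : Fin m => P) i).integrable_comp_of_integrable hFsh
  have hEi : Integrable E (Measure.pi fun _ : Fin m => P) := integrable_finsetSum _ fun i _ => hEint i
  have hEv : ∫ x, E x ∂(Measure.pi fun _ : Fin m => P) = m * (1/2 - ∫ x, F (x - μ) ∂P) := by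
    simp only [hE]
    rw [integral_finsetSum _ fun i _ => hEint i]
    have : ∀ i : Fin m, ∫ x : Fin m → ℝ, (F (x i) - F (x i - μ)) ∂(Measure.pi fun _ : Fin m => P) = 1/2 - ∫ x, F (x - μ) ∂P := by
      intro i
      have hmp := measurePreserving_eval (fun _ : Fin m => P) i
      have := integral_map (μ := Measure.pi fun _ : Fin m => P) hmp.measurable.aemeasurable
        (f := fun y => F y - F (y-μ)) (by rw [hmp.map_eq]; exact hFsh.aestronglyMeasurable)
      rw [hmp.map_eq, hFval] at this
      exact this.symm
    simp only [this]
    rw [Finset.sum_const, Finset.card_univ, Fintype.card_fin, nsmul_eq_mul]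
  have hΔ : 0 ≤ 1/2 - ∫ x, F (x - μ) ∂P := by
    rw [← hFval]; exact integral_nonneg fun y => sub_nonneg.2 (F_mono P F hF (by linarith))
  set Δ := 1/2 - ∫ x, F (x - μ) ∂P with hΔd
  have hI1 : Integrable (fun x => 16 / (m:ℝ) * pcnt F (κ/m) x) (Measure.pi fun _ : Fin m => P) := pi1.const_mul _
  have hI2 : Integrable (fun x => √2 * √n * ε * E x / s0) (Measure.pi fun _ : Fin m => P) := (hEi.const_mul _).div_const _
  have hI3 : Integrable (fun x => √2 * √n * ε * E x / s0 + √2/√((n:ℝ)+1)) (Measure.pi fun _ : Fin m => P) := hI2.add (integrable_const _)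
  refine abs_integral_le_integral_abs.trans ((integral_mono_of_nonneg (ae_of_all _ fun _ => abs_nonneg _)
    (hI1.add (hI3.const_mul _)) hpt).trans ?_)
  rw [integral_add' hI1 (hI3.const_mul _), integral_const_mul, integral_const_mul, integral_add hI2 (integrable_const _),
    integral_div, integral_const_mul, hEv]
  simp only [integral_const, probReal_univ, one_smul]
  have t1 : 16 / (m:ℝ) * ∫ x : Fin m → ℝ, (pcnt F (κ/m) x : ℝ) ∂(Measure.pi (fun _ : Fin m => P)) ≤ 32 * κ := by
    calc _ ≤ 16 / (m:ℝ) * ((m:ℝ)^2 * (2 * (κ/m))) := by gcongr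
      _ = _ := by field_simp; norm_num
  have t2 : √2 * √n * ε * (m * Δ) / s0 ≤ 8 * √2 * (√n * ε * Δ) := by
    rw [div_le_iff₀ hs0p']
    have : 0 ≤ √2 * √n * ε * Δ := by positivity
    nlinarith
  gcongr

lemma sq_sum_pi (P : Measure ℝ) [IsProbabilityMeasure P] (n : ℕ) (g : ℝ → ℝ) (hg : Measurable g) (C : ℝ)
    (hC : ∀ y, |g y| ≤ C) (h0 : ∫ y, g y ∂P = 0) :
    ∫ y, (∑ j, g (y j))^2 ∂(Measure.pi fun _ : Fin n => P) = n * ∫ y, g y ^ 2 ∂P := by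
  have hm : MemLp g 2 P := MemLp.of_bound hg.aestronglyMeasurable C (ae_of_all _ hC)
  have h := variance_sum_pi (ι := Fin n) (μ := fun _ => P) (X := fun _ => g) (fun _ => hm)
  have hi : ∀ j : Fin n, Integrable (fun y : Fin n → ℝ => g (y j)) (Measure.pi fun _ : Fin n => P) := fun j =>
    (measurePreserving_eval (fun _ : Fin n => P) j).integrable_comp_of_integrable (hm.integrable (by norm_num))
  have hv : ∀ j : Fin n, ∫ y : Fin n → ℝ, g (y j) ∂(Measure.pi fun _ : Fin n => P) = 0 := by
    intro j
    have hmp := measurePreserving_eval (fun _ : Fin n => P) j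
    have := integral_map (μ := Measure.pi fun _ : Fin n => P) hmp.measurable.aemeasurable
      (f := g) hg.aestronglyMeasurable
    rw [hmp.map_eq, h0] at this
    exact this.symm
  have e : (∑ j : Fin n, fun ω : Fin n → ℝ => g (ω j)) = fun ω => ∑ j, g (ω j) := by
    ext ω; simp
  have hme : Measurable (fun ω : Fin n → ℝ => ∑ j, g (ω j)) :=
    Finset.measurable_sum _ fun j _ => hg.comp (measurable_pi_apply j)
  rw [e, variance_of_integral_eq_zero hme.aemeasurable (by rw [integral_finsetSum _ fun j _ => hi j]; simp [hv])] at h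
  simp only [variance_of_integral_eq_zero hg.aemeasurable h0] at h
  rw [Finset.sum_const, Finset.card_univ, Fintype.card_fin, nsmul_eq_mul] at h
  exact h

noncomputable def hker (F : ℝ → ℝ) (x y : ℝ) : ℝ := (if x < y then 1 else 0) - F y + F x - 1/2

lemma hker_meas (F : ℝ → ℝ) (hFcont : Continuous F) : Measurable (fun p : ℝ × ℝ => hker F p.1 p.2) := by
  unfold hker
  have : Measurable (fun p : ℝ × ℝ => if p.1 < p.2 then (1:ℝ) else 0) :=
    Measurable.ite (measurableSet_lt (by fun_prop) (by fun_prop)) measurable_const measurable_const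
  have := hFcont.measurable
  fun_prop

lemma hker_bd (P : Measure ℝ) [IsProbabilityMeasure P]
    (F : ℝ → ℝ) (hF : ∀ t, F t = (P (Set.Iic t)).toReal) (x y : ℝ) : |hker F x y| ≤ 2 := by
  have a := F_nonneg P F hF x
  have b := F_nonneg P F hF y
  have a' := F_le_one P F hF x
  have b' := F_le_one P F hF y
  unfold hker
  rw [abs_le]; split_ifs <;> constructor <;> linarith

lemma F_int (P : Measure ℝ) [IsProbabilityMeasure P]
    (F : ℝ → ℝ) (hF : ∀ t, F t = (P (Set.Iic t)).toReal) (hFcont : Continuous F) : Integrable F P :=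
  Integrable.of_bound hFcont.aestronglyMeasurable 1 (ae_of_all _ fun y => by
        rw [Real.norm_eq_abs, abs_of_nonneg (F_nonneg P F hF _)]; exact F_le_one P F hF _)

lemma hker_int_x (P : Measure ℝ) [IsProbabilityMeasure P]
    (F : ℝ → ℝ) (hF : ∀ t, F t = (P (Set.Iic t)).toReal) (hFcont : Continuous F) (y : ℝ) :
    ∫ x, hker F x y ∂P = 0 := by
  have e : (fun x => hker F x y) = fun x => ((Iio y).indicator (fun _ => (1:ℝ)) x - F y) + (F x - 1/2) := by
    ext x; simp only [hker, indicator_apply, mem_Iio]; ring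
  have hi1 : Integrable ((Iio y).indicator (fun _ => (1:ℝ))) P := (integrable_const _).indicator measurableSet_Iio
  have hi := F_int P F hF hFcont
  have hs1 : Integrable (fun x => (Iio y).indicator (fun _ => (1:ℝ)) x - F y) P := hi1.sub (integrable_const _)
  have hs2 : Integrable (fun x => F x - 1/2) P := hi.sub (integrable_const _)
  rw [e, integral_add hs1 hs2, integral_sub hi1 (integrable_const _),
    integral_sub hi (integrable_const _), F_mean P F hF hFcont, integral_indicator measurableSet_Iio]
  simp [P_Iio P F hF hFcont]

lemma hker_int_y (P : Measure ℝ) [IsProbabilityMeasure P]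
    (F : ℝ → ℝ) (hF : ∀ t, F t = (P (Set.Iic t)).toReal) (hFcont : Continuous F) (x : ℝ) :
    ∫ y, hker F x y ∂P = 0 := by
  have e : (fun y => hker F x y) = fun y => ((Ioi x).indicator (fun _ => (1:ℝ)) y - F y) + (F x - 1/2) := by
    ext y; simp only [hker, indicator_apply, mem_Ioi]; ring
  have hi1 : Integrable ((Ioi x).indicator (fun _ => (1:ℝ))) P := (integrable_const _).indicator measurableSet_Ioi
  have hi := F_int P F hF hFcont
  have hx : P.real (Ioi x) = 1 - F x := by
    rw [← compl_Iic, probReal_compl_eq_one_sub measurableSet_Iic, hF]; rfl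
  have hs1 : Integrable (fun y => (Ioi x).indicator (fun _ => (1:ℝ)) y - F y) P := hi1.sub hi
  rw [e, integral_add hs1 (integrable_const _), integral_sub hi1 hi,
     F_mean P F hF hFcont, integral_indicator measurableSet_Ioi]
  simp [hx]; ring

noncomputable def Rst {m n : ℕ} (F : ℝ → ℝ) (ω : (Fin m → ℝ) × (Fin n → ℝ)) : ℝ :=
  ∑ j, ∑ i, hker F (ω.1 i) (ω.2 j)

lemma Rst_meas (F : ℝ → ℝ) (hFcont : Continuous F) (m n : ℕ) : Measurable (Rst (m := m) (n := n) F) := by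
  unfold Rst
  refine Finset.measurable_sum _ fun j _ => Finset.measurable_sum _ fun i _ => ?_
  exact (hker_meas F hFcont).comp (f := fun ω : (Fin m → ℝ) × (Fin n → ℝ) => (ω.1 i, ω.2 j)) (by fun_prop)

lemma Rst_bd (P : Measure ℝ) [IsProbabilityMeasure P]
    (F : ℝ → ℝ) (hF : ∀ t, F t = (P (Set.Iic t)).toReal) (m n : ℕ) (ω : (Fin m → ℝ) × (Fin n → ℝ)) :
    |Rst F ω| ≤ n * (m * 2) := by
  unfold Rst
  refine (Finset.abs_sum_le_sum_abs _ _).trans ?_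
  calc _ ≤ ∑ j : Fin n, ((m:ℝ) * 2) := by
        refine Finset.sum_le_sum fun j _ => (Finset.abs_sum_le_sum_abs _ _).trans ?_
        calc _ ≤ ∑ i : Fin m, (2:ℝ) := Finset.sum_le_sum fun i _ => hker_bd P F hF _ _
          _ = _ := by simp
    _ = _ := by simp

lemma Rst_sq (P : Measure ℝ) [IsProbabilityMeasure P]
    (F : ℝ → ℝ) (hF : ∀ t, F t = (P (Set.Iic t)).toReal) (hFcont : Continuous F) (m n : ℕ) :
    ∫ ω, (Rst F ω)^2 ∂((Measure.pi fun _ : Fin m => P).prod (Measure.pi fun _ : Fin n => P)) ≤ 4 * m * n := by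
  have hmeas := Rst_meas F hFcont m n
  have hbd := Rst_bd P F hF m n
  have hI : Integrable (fun ω => (Rst F ω)^2) ((Measure.pi fun _ : Fin m => P).prod (Measure.pi fun _ : Fin n => P)) := by
    refine Integrable.of_bound (hmeas.pow_const 2).aestronglyMeasurable ((n * (m * 2))^2) (ae_of_all _ fun ω => ?_)
    rw [norm_pow, Real.norm_eq_abs]
    exact pow_le_pow_left₀ (abs_nonneg _) (hbd ω) 2
  rw [integral_prod _ hI]
  set S : (Fin m → ℝ) × ℝ → ℝ := fun q => ∑ i, hker F (q.1 i) q.2 with hS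
  have hSm : Measurable S := Finset.measurable_sum _ fun i _ =>
    (hker_meas F hFcont).comp (f := fun q : (Fin m → ℝ) × ℝ => (q.1 i, q.2)) (by fun_prop)
  have hSb : ∀ q, |S q| ≤ m * 2 := by
    intro q
    refine (Finset.abs_sum_le_sum_abs _ _).trans ?_
    calc _ ≤ ∑ i : Fin m, (2:ℝ) := Finset.sum_le_sum fun i _ => hker_bd P F hF _ _
      _ = _ := by simp
  have hSI : Integrable (fun q => (S q)^2) ((Measure.pi fun _ : Fin m => P).prod P) := by
    refine Integrable.of_bound (hSm.pow_const 2).aestronglyMeasurable ((m * 2)^2) (ae_of_all _ fun ω => ?_)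
    rw [norm_pow, Real.norm_eq_abs]
    exact pow_le_pow_left₀ (abs_nonneg _) (hSb ω) 2
  have hk : ∀ y, Measurable fun x => hker F x y := fun y =>
    (hker_meas F hFcont).comp (f := fun x => (x, y)) (by fun_prop)
  have hk' : ∀ x, Measurable fun y => hker F x y := fun x =>
    (hker_meas F hFcont).comp (f := fun y => (x, y)) (by fun_prop)
  have e1 : ∀ x : Fin m → ℝ, ∫ y, (Rst F (x, y))^2 ∂(Measure.pi fun _ : Fin n => P) = n * ∫ y, S (x, y)^2 ∂P := by
    intro x
    refine sq_sum_pi P n (fun y => S (x, y)) (hSm.comp (by fun_prop)) (m*2) (fun y => hSb _) ?_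
    simp only [hS]
    rw [integral_finsetSum]
    · simp [hker_int_y P F hF hFcont]
    · intro i _
      exact Integrable.of_bound (hk' _).aestronglyMeasurable 2 (ae_of_all _ fun y => hker_bd P F hF _ _)
  simp only [e1]
  rw [integral_const_mul, integral_integral_swap (f := fun x y => S (x, y)^2) hSI]
  have e2 : ∀ y : ℝ, ∫ x, (S (x, y))^2 ∂(Measure.pi fun _ : Fin m => P) = m * ∫ x, hker F x y ^2 ∂P := fun y =>
    sq_sum_pi P m (fun x => hker F x y) (hk y) 2 (fun x => hker_bd P F hF _ _) (hker_int_x P F hF hFcont y)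
  simp only [e2]
  rw [integral_const_mul]
  have e3 : ∫ y, ∫ x, hker F x y ^2 ∂P ∂P ≤ 4 := by
    have hh : ∀ y, ‖∫ x, hker F x y ^2 ∂P‖ ≤ 4 := by
      intro y
      have := norm_integral_le_of_norm_le_const (μ := P) (f := fun x => hker F x y ^ 2) (C := 4) (ae_of_all _ fun x => by
        rw [norm_pow, Real.norm_eq_abs]
        have := pow_le_pow_left₀ (abs_nonneg _) (hker_bd P F hF x y) 2
        linarith)
      simpa using this
    have := norm_integral_le_of_norm_le_const (μ := P) (C := 4) (ae_of_all _ hh)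
    refine (le_abs_self _).trans ?_
    simpa using this
  have : (0:ℝ) ≤ n * m := by positivity
  nlinarith

lemma Rst_abs (P : Measure ℝ) [IsProbabilityMeasure P]
    (F : ℝ → ℝ) (hF : ∀ t, F t = (P (Set.Iic t)).toReal) (hFcont : Continuous F) (m n : ℕ) :
    ∫ ω, |Rst F ω| ∂((Measure.pi fun _ : Fin m => P).prod (Measure.pi fun _ : Fin n => P)) ≤ 2 * √((m:ℝ) * n) := by
  set Pr := ((Measure.pi fun _ : Fin m => P).prod (Measure.pi fun _ : Fin n => P))
  have hmeas := Rst_meas F hFcont m n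
  have hbd := Rst_bd P F hF m n
  have hL : MemLp (fun ω => |Rst F ω|) 2 Pr := MemLp.of_bound (by fun_prop) (n * (m * 2)) (ae_of_all _ fun ω => by
    simpa using hbd ω)
  have hv := variance_nonneg (fun ω => |Rst F ω|) Pr
  rw [variance_eq_sub hL] at hv
  have h2 := Rst_sq P F hF hFcont m n
  simp only [Pi.pow_apply, sq_abs] at hv
  have h3 : 2 * √((m:ℝ) * n) = √(4 * m * n) := by
    rw [show (4:ℝ) * m * n = 2^2 * (m * n) by ring, Real.sqrt_mul (by norm_num : (0:ℝ) ≤ 2^2),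
      Real.sqrt_sq (by norm_num : (0:ℝ) ≤ 2)]
  rw [h3]
  apply Real.le_sqrt_of_sq_le
  linarith

lemma Rst_eq (F : ℝ → ℝ) (m n : ℕ) (ω : (Fin m → ℝ) × (Fin n → ℝ)) :
    (Ustat ω.1 ω.2 : ℝ) - (m:ℝ) * n / 2 = Rst F ω +
      (-(n:ℝ) * ∑ i, (F (ω.1 i) - 1/2) + m * ∑ j, (F (ω.2 j) - 1/2)) := by
  have hU : (Ustat ω.1 ω.2 : ℝ) = ∑ j, ∑ i, (if ω.1 i < ω.2 j then (1:ℝ) else 0) := by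
    rw [Ustat, Finset.card_filter, Finset.sum_product_right]; push_cast; rfl
  rw [hU, Rst]
  simp only [hker, Finset.sum_add_distrib, Finset.sum_sub_distrib, Finset.sum_const, Finset.card_univ, Fintype.card_fin,
    nsmul_eq_mul, ← Finset.mul_sum]
  ring

noncomputable def psi (P : Measure ℝ) (F : ℝ → ℝ) (s : ℝ) : ℂ := ∫ y, Complex.exp (Complex.I * ((s * (F y - 1/2) : ℝ) : ℂ)) ∂P

lemma norm_exp_I (r : ℝ) : ‖Complex.exp (Complex.I * (r:ℂ))‖ = 1 := by
  rw [mul_comm]; exact Complex.norm_exp_ofReal_mul_I r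

lemma psi_norm (P : Measure ℝ) [IsProbabilityMeasure P] (F : ℝ → ℝ) (s : ℝ) : ‖psi P F s‖ ≤ 1 := by
  have := norm_integral_le_of_norm_le_const (μ := P) (C := 1)
    (ae_of_all _ fun y => (norm_exp_I (s * (F y - 1/2))).le)
  simpa [psi] using this

lemma psi_est (P : Measure ℝ) [IsProbabilityMeasure P]
    (F : ℝ → ℝ) (hF : ∀ t, F t = (P (Set.Iic t)).toReal) (hFcont : Continuous F) (s : ℝ) (hs : |s| ≤ 1) :
    ‖psi P F s - Complex.exp ((-(s^2/24) : ℝ) : ℂ)‖ ≤ 2 * |s|^3 := by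
  set G : ℝ → ℝ := fun y => F y - 1/2 with hG
  have hGc : Continuous G := by fun_prop
  have hGb : ∀ y, |G y| ≤ 1 := fun y => by
    have a := F_nonneg P F hF y
    have a' := F_le_one P F hF y
    simp only [hG]; rw [abs_le]; constructor <;> linarith
  have hGi : Integrable G P := Integrable.of_bound hGc.aestronglyMeasurable 1 (ae_of_all _ hGb)
  have hG2i : Integrable (fun y => (G y)^2) P := Integrable.of_bound (hGc.pow 2).aestronglyMeasurable 1 (ae_of_all _ fun y => by
    rw [norm_pow, Real.norm_eq_abs]; exact pow_le_one₀ (abs_nonneg _) (hGb y))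
  have hG0 : ∫ y, G y ∂P = 0 := by
    simp only [hG]
    rw [integral_sub (F_int P F hF hFcont) (integrable_const _), F_mean P F hF hFcont]; simp
  have hG2 : ∫ y, (G y)^2 ∂P = 1/12 := F_var P F hF hFcont
  have hei : Integrable (fun y => Complex.exp (Complex.I * ((s * G y : ℝ) : ℂ))) P :=
    Integrable.of_bound (by fun_prop) 1 (ae_of_all _ fun y => (norm_exp_I _).le)
  have hq1 : Integrable (fun y => Complex.I * s * (G y : ℂ)) P := hGi.ofReal.const_mul _
  have hq2 : Integrable (fun y => ((s:ℂ)^2/2) * (((G y)^2 : ℝ) : ℂ)) P := hG2i.ofReal.const_mul _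
  have hq12 : Integrable (fun y => 1 + Complex.I * s * (G y : ℂ)) P := (integrable_const _).add hq1
  have hqv : ∫ y, (1 + Complex.I * s * (G y : ℂ) - ((s:ℂ)^2/2) * (((G y)^2 : ℝ) : ℂ)) ∂P = ((1 - s^2/24 : ℝ) : ℂ) := by
    rw [integral_sub hq12 hq2, integral_add (integrable_const _) hq1, integral_const_mul, integral_const_mul,
      integral_complex_ofReal, integral_complex_ofReal, hG0, hG2]
    simp; ring
  have h1 : ‖psi P F s - ((1 - s^2/24 : ℝ) : ℂ)‖ ≤ |s|^3 := by
    have hq3 : Integrable (fun y => 1 + Complex.I * s * (G y : ℂ) - ((s:ℂ)^2/2) * (((G y)^2 : ℝ) : ℂ)) P := hq12.sub hq2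
    have hps : psi P F s = ∫ y, Complex.exp (Complex.I * ((s * G y : ℝ) : ℂ)) ∂P := rfl
    rw [← hqv, hps, ← integral_sub hei hq3]
    have := norm_integral_le_of_norm_le_const (μ := P) (C := |s|^3)
      (f := fun y => Complex.exp (Complex.I * ((s * G y : ℝ) : ℂ)) - (1 + Complex.I * s * (G y : ℂ) - ((s:ℂ)^2/2) * (((G y)^2 : ℝ) : ℂ)))
      (ae_of_all _ fun y => ?_)
    · simpa using this
    · have hx : ‖Complex.I * ((s * G y : ℝ) : ℂ)‖ = |s| * |G y| := by
        rw [norm_mul, Complex.norm_I, one_mul, Complex.norm_real, Real.norm_eq_abs, abs_mul]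
      have hle : |s| * |G y| ≤ |s| := mul_le_of_le_one_right (abs_nonneg _) (hGb y)
      have hb := Complex.exp_bound (x := Complex.I * ((s * G y : ℝ) : ℂ)) (by rw [hx]; linarith) (n := 3) (by norm_num)
      have e : ∑ k ∈ Finset.range 3, (Complex.I * ((s * G y : ℝ) : ℂ))^k / (Nat.factorial k : ℂ) =
          (1 + Complex.I * s * (G y : ℂ) - ((s:ℂ)^2/2) * (((G y)^2 : ℝ) : ℂ)) := by
        simp [Finset.sum_range_succ, Nat.factorial, mul_pow]; ring
      rw [e, hx] at hb
      refine hb.trans ?_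
      have : (|s| * |G y|)^3 ≤ |s|^3 := pow_le_pow_left₀ (by positivity) hle 3
      have h3 : ((Nat.succ 3 : ℕ) : ℝ) * (((Nat.factorial 3 : ℕ) : ℝ) * (3:ℕ))⁻¹ ≤ 1 := by
        norm_num [Nat.factorial]
      exact (mul_le_of_le_one_right (by positivity) h3).trans this
  have h2 : ‖((1 - s^2/24 : ℝ) : ℂ) - Complex.exp ((-(s^2/24) : ℝ) : ℂ)‖ ≤ |s|^3 := by
    rw [← Complex.ofReal_exp, ← Complex.ofReal_sub, Complex.norm_real, Real.norm_eq_abs, abs_sub_comm]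
    have hs2 : s^2 ≤ 1 := by rw [← sq_abs]; exact pow_le_one₀ (abs_nonneg _) hs
    have := Real.abs_exp_sub_one_sub_id_le (x := -(s^2/24)) (by rw [abs_neg, abs_of_nonneg (by positivity)]; linarith)
    rw [show Real.exp (-(s^2/24)) - (1 - s^2/24) = Real.exp (-(s^2/24)) - 1 - -(s^2/24) by ring]
    refine this.trans ?_
    have h4 : s^4 ≤ |s|^3 := by
      calc s^4 = |s|^3 * |s| := by
            have : |s|^2 = s^2 := sq_abs s
            linear_combination (-(|s|^2 + s^2)) * this
        _ ≤ |s|^3 := mul_le_of_le_one_right (by positivity) hs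
    nlinarith [sq_nonneg (s^2)]
  calc _ = ‖(psi P F s - ((1 - s^2/24 : ℝ) : ℂ)) + (((1 - s^2/24 : ℝ) : ℂ) - Complex.exp ((-(s^2/24) : ℝ) : ℂ))‖ := by congr 1; ring
    _ ≤ _ := (norm_add_le _ _).trans (by linarith)

lemma pow_sub_le (a b : ℂ) (ha : ‖a‖ ≤ 1) (hb : ‖b‖ ≤ 1) (m : ℕ) : ‖a^m - b^m‖ ≤ m * ‖a - b‖ := by
  induction m with
  | zero => simp
  | succ m ih =>
    rw [show a^(m+1) - b^(m+1) = a^m * (a - b) + (a^m - b^m) * b by ring]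
    refine (norm_add_le _ _).trans ?_
    rw [norm_mul, norm_mul, norm_pow]
    have h1 : ‖a‖^m ≤ 1 := pow_le_one₀ (norm_nonneg _) ha
    push_cast
    have := mul_le_of_le_one_left (norm_nonneg (a-b)) h1
    have := mul_le_of_le_one_right (norm_nonneg (a^m-b^m)) hb
    linarith

lemma psi_pow (P : Measure ℝ) [IsProbabilityMeasure P]
    (F : ℝ → ℝ) (hF : ∀ t, F t = (P (Set.Iic t)).toReal) (hFcont : Continuous F) (s : ℝ) (hs : |s| ≤ 1) (m : ℕ) :
    ‖(psi P F s)^m - Complex.exp ((-(m * s^2/24) : ℝ) : ℂ)‖ ≤ 2 * (m * |s|^3) := by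
  have h := psi_est P F hF hFcont s hs
  have e : Complex.exp ((-(m * s^2/24) : ℝ) : ℂ) = (Complex.exp ((-(s^2/24) : ℝ) : ℂ))^m := by
    rw [← Complex.exp_nat_mul]; congr 1; push_cast; ring
  rw [e]
  refine (pow_sub_le _ _ (psi_norm P F s) ?_ m).trans ?_
  · rw [← Complex.ofReal_exp, Complex.norm_real, Real.norm_eq_abs, abs_of_pos (Real.exp_pos _)]
    apply Real.exp_le_one_iff.2
    have : 0 ≤ s^2/24 := by positivity
    linarith
  · calc _ ≤ (m:ℝ) * (2 * |s|^3) := by gcongr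
      _ = _ := by ring

lemma lin_char (P : Measure ℝ) [IsProbabilityMeasure P] (F : ℝ → ℝ) (m n : ℕ) (s r : ℝ) :
    ∫ ω, Complex.exp (Complex.I * ((s * ∑ i, (F (ω.1 i) - 1/2) + r * ∑ j, (F (ω.2 j) - 1/2) : ℝ) : ℂ))
      ∂((Measure.pi fun _ : Fin m => P).prod (Measure.pi fun _ : Fin n => P)) = (psi P F s)^m * (psi P F r)^n := by
  have e : ∀ ω : (Fin m → ℝ) × (Fin n → ℝ),
      Complex.exp (Complex.I * ((s * ∑ i, (F (ω.1 i) - 1/2) + r * ∑ j, (F (ω.2 j) - 1/2) : ℝ) : ℂ)) =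
      (∏ i, Complex.exp (Complex.I * ((s * (F (ω.1 i) - 1/2) : ℝ) : ℂ))) *
      (∏ j, Complex.exp (Complex.I * ((r * (F (ω.2 j) - 1/2) : ℝ) : ℂ))) := by
    intro ω
    rw [← Complex.exp_sum, ← Complex.exp_sum, ← Complex.exp_add]
    congr 1
    rw [← Finset.mul_sum, ← Finset.mul_sum, ← mul_add, ← Complex.ofReal_sum, ← Complex.ofReal_sum, ← Complex.ofReal_add,
      Finset.mul_sum, Finset.mul_sum]
  simp only [e]
  rw [integral_prod_mul (fun x : Fin m → ℝ => ∏ i, Complex.exp (Complex.I * ((s * (F (x i) - 1/2) : ℝ) : ℂ)))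
    (fun y : Fin n → ℝ => ∏ j, Complex.exp (Complex.I * ((r * (F (y j) - 1/2) : ℝ) : ℂ)))]
  rw [integral_fintype_prod_eq_pow (fun x => Complex.exp (Complex.I * ((s * (F x - 1/2) : ℝ) : ℂ))),
   integral_fintype_prod_eq_pow (fun x => Complex.exp (Complex.I * ((r * (F x - 1/2) : ℝ) : ℂ)))]
  simp [psi]

lemma cube_bd (m : ℝ) (hm : 0 < m) (s c : ℝ) (hc : 0 ≤ c) (h : s^2 ≤ c^2/m) :
    |s| ≤ c / √m ∧ m * |s|^3 ≤ c^3/√m := by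
  have h1 : |s| ≤ c / √m := by
    apply abs_le_of_sq_le_sq _ (by positivity)
    rw [div_pow, Real.sq_sqrt hm.le]; exact h
  refine ⟨h1, ?_⟩
  have h2 : |s|^3 ≤ (c/√m)^3 := pow_le_pow_left₀ (abs_nonneg _) h1 3
  calc m * |s|^3 ≤ m * (c/√m)^3 := by gcongr
    _ = c^3/√m := by
      have h3 : √m ^ 2 = m := Real.sq_sqrt hm.le
      have h4 : √m ≠ 0 := by positivity
      rw [div_pow, mul_div_assoc', div_eq_div_iff (by positivity) h4]
      linear_combination (- c^3 * √m) * h3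

lemma char_bound (P : Measure ℝ) [IsProbabilityMeasure P]
    (F : ℝ → ℝ) (hF : ∀ t, F t = (P (Set.Iic t)).toReal) (hFcont : Continuous F) (m n : ℕ) (hm : 1 ≤ m) (hn : 1 ≤ n)
    (t : ℝ) (hcm : √12 * |t| ≤ √m) (hcn : √12 * |t| ≤ √n) :
    ‖(∫ ω, Complex.exp (Complex.I * ((t * (((Ustat ω.1 ω.2 : ℝ) - (m : ℝ) * n / 2) /
            Real.sqrt ((m : ℝ) * n * ((m : ℝ) + n + 1) / 12)) : ℝ) : ℂ))
      ∂((Measure.pi fun _ : Fin m => P).prod (Measure.pi fun _ : Fin n => P))) -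
      Complex.exp ((-(t^2/2 * (1 - 1/((m:ℝ)+n+1))) : ℝ) : ℂ)‖ ≤
    |t| * (2 * √12) / √((m:ℝ)+n+1) + 2 * ((√12 * |t|)^3/√m) + 2 * ((√12 * |t|)^3/√n) := by
  set Pr := ((Measure.pi fun _ : Fin m => P).prod (Measure.pi fun _ : Fin n => P)) with hPr
  set σ := Real.sqrt ((m : ℝ) * n * ((m : ℝ) + n + 1) / 12) with hσ
  have hm0 : (0:ℝ) < m := by positivity
  have hn0 : (0:ℝ) < n := by positivity
  have hσ0 : 0 < σ := by positivity
  have hσ2 : σ^2 = (m : ℝ) * n * ((m : ℝ) + n + 1) / 12 := Real.sq_sqrt (by positivity)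
  set s := -(t * n / σ) with hs
  set r := t * m / σ with hr
  have hs2 : s^2 = 12 * t^2 * n / (m * (m+n+1)) := by
    rw [hs, neg_sq, div_pow, hσ2]; field_simp
  have hr2 : r^2 = 12 * t^2 * m / (n * (m+n+1)) := by
    rw [hr, div_pow, hσ2]; field_simp
  have hc2 : (√12 * |t|)^2 = 12 * t^2 := by
    rw [mul_pow, sq_abs, Real.sq_sqrt (by norm_num)]
  have hcs := cube_bd m hm0 s (√12 * |t|) (by positivity) (by
    rw [hc2, hs2, div_le_div_iff₀ (by positivity) hm0]
    have : 0 ≤ 12 * t^2 * m * (m+1) := by positivity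
    nlinarith)
  have hcr := cube_bd n hn0 r (√12 * |t|) (by positivity) (by
    rw [hc2, hr2, div_le_div_iff₀ (by positivity) hn0]
    have : 0 ≤ 12 * t^2 * n * (n+1) := by positivity
    nlinarith)
  have hs1 : |s| ≤ 1 := hcs.1.trans ((div_le_one (by positivity)).2 hcm)
  have hr1 : |r| ≤ 1 := hcr.1.trans ((div_le_one (by positivity)).2 hcn)
  have ps := psi_pow P F hF hFcont s hs1 m
  have pr := psi_pow P F hF hFcont r hr1 n
  have hFm := hFcont.measurable
  set Lf : (Fin m → ℝ) × (Fin n → ℝ) → ℝ := fun ω => s * ∑ i, (F (ω.1 i) - 1/2) + r * ∑ j, (F (ω.2 j) - 1/2) with hLf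
  have hLm : Measurable Lf := by fun_prop
  set Zf : (Fin m → ℝ) × (Fin n → ℝ) → ℝ := fun ω => t * (((Ustat ω.1 ω.2 : ℝ) - (m : ℝ) * n / 2) / σ) with hZf
  have hZm : Measurable Zf := by
    have : Measurable (fun ω : (Fin m → ℝ) × (Fin n → ℝ) => (Ustat ω.1 ω.2 : ℝ)) :=
      (measurable_of_countable (Nat.cast : ℕ → ℝ)).comp (Ustat_meas m n)
    fun_prop
  have hZL : ∀ ω, Zf ω = Lf ω + t / σ * Rst F ω := by
    intro ω
    simp only [hZf, hLf]
    rw [Rst_eq F m n ω, hs, hr]; field_simp; ring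
  have hint : ∀ f : (Fin m → ℝ) × (Fin n → ℝ) → ℝ, Measurable f →
      Integrable (fun ω => Complex.exp (Complex.I * (f ω : ℂ))) Pr := fun f hf =>
    Integrable.of_bound (by fun_prop) 1 (ae_of_all _ fun y => (norm_exp_I _).le)
  have hRi : Integrable (fun ω => |Rst F ω|) Pr :=
    Integrable.of_bound (Rst_meas F hFcont m n).abs.aestronglyMeasurable (n * (m*2)) (ae_of_all _ fun ω => by
      simpa using Rst_bd P F hF m n ω)
  have hlin : ∫ ω, Complex.exp (Complex.I * (Lf ω : ℂ)) ∂Pr = (psi P F s)^m * (psi P F r)^n := lin_char P F m n s r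
  have d1 : ‖(∫ ω, Complex.exp (Complex.I * (Zf ω : ℂ)) ∂Pr) - ∫ ω, Complex.exp (Complex.I * (Lf ω : ℂ)) ∂Pr‖ ≤
      |t| * (2 * √12) / √((m:ℝ)+n+1) := by
    rw [← integral_sub (hint _ hZm) (hint _ hLm)]
    calc _ ≤ ∫ ω, |t|/σ * |Rst F ω| ∂Pr := by
          refine norm_integral_le_of_norm_le (hRi.const_mul _) (ae_of_all _ fun ω => ?_)
          have e : Complex.exp (Complex.I * (Zf ω : ℂ)) - Complex.exp (Complex.I * (Lf ω : ℂ)) =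
              Complex.exp (Complex.I * (Lf ω : ℂ)) * (Complex.exp (Complex.I * ((t / σ * Rst F ω : ℝ) : ℂ)) - 1) := by
            rw [mul_sub, ← Complex.exp_add, hZL ω]; push_cast; ring_nf
          rw [e, norm_mul, norm_exp_I, one_mul]
          refine Real.norm_exp_I_mul_ofReal_sub_one_le.trans (le_of_eq ?_)
          rw [Real.norm_eq_abs, abs_mul, abs_div, abs_of_pos hσ0]
      _ = |t|/σ * ∫ ω, |Rst F ω| ∂Pr := integral_const_mul _ _
      _ ≤ |t|/σ * (2 * √((m:ℝ) * n)) := by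
          gcongr; exact Rst_abs P F hF hFcont m n
      _ = _ := by
          have : σ = √((m:ℝ)*n) * √((m:ℝ)+n+1) / √12 := by
            rw [hσ, Real.sqrt_div (by positivity), Real.sqrt_mul (by positivity)]
          have a1 : √((m:ℝ)*n) ≠ 0 := by positivity
          have a2 : √((m:ℝ)+n+1) ≠ 0 := by positivity
          have a3 : √(12:ℝ) ≠ 0 := by positivity
          rw [this]
          generalize √((m:ℝ)*n) = u at *
          generalize √((m:ℝ)+n+1) = v at *
          generalize √(12:ℝ) = w at *
          field_simp
  set a : ℂ := Complex.exp ((-(m * s^2/24) : ℝ) : ℂ) with ha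
  set b : ℂ := Complex.exp ((-(n * r^2/24) : ℝ) : ℂ) with hb
  have hab : Complex.exp ((-(t^2/2 * (1 - 1/((m:ℝ)+n+1))) : ℝ) : ℂ) = a * b := by
    rw [ha, hb, ← Complex.exp_add, ← Complex.ofReal_add]
    congr 2
    rw [hs2, hr2]
    have : (m:ℝ)+n+1 ≠ 0 := by positivity
    field_simp; ring
  have han : ‖a‖ ≤ 1 := by
    rw [ha, ← Complex.ofReal_exp, Complex.norm_real, Real.norm_eq_abs, abs_of_pos (Real.exp_pos _)]
    apply Real.exp_le_one_iff.2
    have : 0 ≤ m * s^2/24 := by positivity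
    linarith
  have d2 : ‖(psi P F s)^m * (psi P F r)^n - a * b‖ ≤ 2 * ((√12 * |t|)^3/√m) + 2 * ((√12 * |t|)^3/√n) := by
    rw [show (psi P F s)^m * (psi P F r)^n - a * b = ((psi P F s)^m - a) * (psi P F r)^n + a * ((psi P F r)^n - b) by ring]
    refine (norm_add_le _ _).trans ?_
    rw [norm_mul, norm_mul]
    have h1 : ‖(psi P F r)^n‖ ≤ 1 := by rw [norm_pow]; exact pow_le_one₀ (norm_nonneg _) (psi_norm P F r)
    have := mul_le_of_le_one_right (norm_nonneg ((psi P F s)^m - a)) h1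
    have := mul_le_of_le_one_left (norm_nonneg ((psi P F r)^n - b)) han
    linarith [hcs.2, hcr.2]
  rw [hab]
  calc _ = ‖((∫ ω, Complex.exp (Complex.I * (Zf ω : ℂ)) ∂Pr) - ∫ ω, Complex.exp (Complex.I * (Lf ω : ℂ)) ∂Pr) +
        ((psi P F s)^m * (psi P F r)^n - a * b)‖ := by rw [hlin]; congr 1; ring
    _ ≤ _ := (norm_add_le _ _).trans (by linarith)

lemma H0_clt (P : Measure ℝ) [IsProbabilityMeasure P]
    (F : ℝ → ℝ) (hF : ∀ t, F t = (P (Set.Iic t)).toReal) (hFcont : Continuous F) (m : ℕ → ℕ)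
    (hm : Tendsto m atTop atTop) (x : ℝ) :
     Tendsto (fun n => (((Measure.pi fun _ : Fin (m n) => P).prod
          (Measure.pi fun _ : Fin n => P))
          {ω | ((Ustat ω.1 ω.2 : ℝ) - (m n : ℝ) * n / 2) /
            Real.sqrt ((m n : ℝ) * n * ((m n : ℝ) + n + 1) / 12) ≤ x}).toReal)
        atTop (𝓝 ((gaussianReal 0 1 (Set.Iic x)).toReal)) := by
  set Z : ∀ n, (Fin (m n) → ℝ) × (Fin n → ℝ) → ℝ := fun n ω => ((Ustat ω.1 ω.2 : ℝ) - (m n : ℝ) * n / 2) /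
            Real.sqrt ((m n : ℝ) * n * ((m n : ℝ) + n + 1) / 12) with hZ
  have hZm : ∀ n, Measurable (Z n) := by
    intro n
    have : Measurable (fun ω : (Fin (m n) → ℝ) × (Fin n → ℝ) => (Ustat ω.1 ω.2 : ℝ)) :=
      (measurable_of_countable (Nat.cast : ℕ → ℝ)).comp (Ustat_meas (m n) n)
    simp only [hZ]
    fun_prop
  let ν : ℕ → ProbabilityMeasure ℝ := fun n => ⟨((Measure.pi fun _ : Fin (m n) => P).prod
          (Measure.pi fun _ : Fin n => P)).map (Z n), Measure.isProbabilityMeasure_map (hZm n).aemeasurable⟩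
  let γ : ProbabilityMeasure ℝ := ⟨gaussianReal 0 1, inferInstance⟩
  have hsq : ∀ u : ℕ → ℝ, Tendsto u atTop atTop → Tendsto (fun n => √(u n)) atTop atTop := fun u hu =>
    Real.tendsto_sqrt_atTop.comp hu
  have hmR : Tendsto (fun n => (m n : ℝ)) atTop atTop := tendsto_natCast_atTop_atTop.comp hm
  have hnR : Tendsto (fun n : ℕ => (n : ℝ)) atTop atTop := tendsto_natCast_atTop_atTop
  have hmn : Tendsto (fun n => (m n : ℝ) + n + 1) atTop atTop :=
    tendsto_atTop_mono (fun n => by have : (0:ℝ) ≤ n := by positivity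
                                    linarith) hmR
  have hlim : Tendsto ν atTop (𝓝 γ) := by
    rw [ProbabilityMeasure.tendsto_iff_tendsto_charFun]
    intro t
    have hγ : charFun (γ : Measure ℝ) t = Complex.exp ((-(t^2/2) : ℝ) : ℂ) := by
      show charFun (gaussianReal 0 1) t = _
      rw [charFun_gaussianReal]; congr 1; push_cast; simp; 
    have hν : ∀ n, charFun (ν n : Measure ℝ) t = ∫ ω, Complex.exp (Complex.I * ((t * Z n ω : ℝ) : ℂ))
        ∂((Measure.pi fun _ : Fin (m n) => P).prod (Measure.pi fun _ : Fin n => P)) := by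
      intro n
      show charFun (Measure.map (Z n) _) t = _
      rw [charFun_apply_real, integral_map (hZm n).aemeasurable (by fun_prop)]
      congr 1; ext ω; congr 1; push_cast; ring_nf
    rw [hγ]
    simp only [hν]
    have l1 : Tendsto (fun n => Complex.exp ((-(t^2/2 * (1 - 1/((m n:ℝ)+n+1))) : ℝ) : ℂ)) atTop
        (𝓝 (Complex.exp ((-(t^2/2) : ℝ) : ℂ))) := by
      have h1 : Tendsto (fun n => 1/((m n:ℝ)+n+1)) atTop (𝓝 0) := by
        simp only [one_div]; exact tendsto_inv_atTop_zero.comp hmn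
      have h2 : Tendsto (fun n => (-(t^2/2 * (1 - 1/((m n:ℝ)+n+1))) : ℝ)) atTop (𝓝 (-(t^2/2))) := by
        have := ((tendsto_const_nhds (x := (1:ℝ))).sub h1).const_mul (t^2/2) |>.neg
        simpa using this
      exact (Complex.continuous_exp.tendsto _).comp ((Complex.continuous_ofReal.tendsto _).comp h2)
    have l2 : Tendsto (fun n : ℕ => |t| * (2 * √12) / √((m n:ℝ)+n+1) + 2 * ((√12 * |t|)^3/√(m n)) + 2 * ((√12 * |t|)^3/√n))
        atTop (𝓝 0) := by
      have a1 := (hsq _ hmn).const_div_atTop (|t| * (2 * √12))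
      have a2 := ((hsq _ hmR).const_div_atTop ((√12 * |t|)^3)).const_mul 2
      have a3 := ((hsq _ hnR).const_div_atTop ((√12 * |t|)^3)).const_mul 2
      simpa using (a1.add a2).add a3
    have l3 : Tendsto (fun n => (∫ ω, Complex.exp (Complex.I * ((t * Z n ω : ℝ) : ℂ))
        ∂((Measure.pi fun _ : Fin (m n) => P).prod (Measure.pi fun _ : Fin n => P))) -
        Complex.exp ((-(t^2/2 * (1 - 1/((m n:ℝ)+n+1))) : ℝ) : ℂ)) atTop (𝓝 0) := by
      refine squeeze_zero_norm' ?_ l2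
      filter_upwards [(hsq _ hmR).eventually_ge_atTop (√12 * |t|), (hsq _ hnR).eventually_ge_atTop (√12 * |t|),
        hm.eventually_ge_atTop 1, eventually_ge_atTop 1] with n h1 h2 h3 h4
      exact char_bound P F hF hFcont (m n) n h3 h4 t h1 h2
    simpa using l3.add l1
  have hfr : (γ : Measure ℝ) (frontier (Iic x)) = 0 := by
    rw [frontier_Iic]
    have : NullSingletonClass (gaussianReal 0 1) := nullSingletonClass_gaussianReal (by norm_num)
    show gaussianReal 0 1 {x} = 0
    exact measure_singleton x
  have := ProbabilityMeasure.tendsto_measure_of_null_frontier_of_tendsto' hlim hfr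
  have h2 := (ENNReal.tendsto_toReal (measure_ne_top (gaussianReal 0 1) (Iic x))).comp this
  refine h2.congr fun n => ?_
  show (Measure.map (Z n) _ (Iic x)).toReal = _
  rw [Measure.map_apply (hZm n) measurableSet_Iic]; rfl

lemma tv_tendsto (P : Measure ℝ) [IsProbabilityMeasure P]
    (F : ℝ → ℝ) (hF : ∀ t, F t = (P (Set.Iic t)).toReal) (hFcont : Continuous F)
    (ε μ : ℕ → ℝ) (hε : ∀ n, ε n ∈ Set.Ioo (0:ℝ) (1/2)) (hμ : ∀ n, 0 < μ n)
    (m : ℕ → ℕ) (hm : Tendsto m atTop atTop)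
    (Q : ℕ → Measure ℝ) [∀ n, IsProbabilityMeasure (Q n)]
    (hQ : ∀ n, Q n = ENNReal.ofReal (1 - ε n) • P + ENNReal.ofReal (ε n) • P.map (· + μ n))
    (h : Tendsto (fun n : ℕ => Real.sqrt n * ε n *
      (1/2 - ∫ x, F (x - μ n) ∂P)) atTop (𝓝 0)) (A : ℕ → Set ℕ) :
    Tendsto (fun n =>
      ((Measure.pi fun _ : Fin (m n) => P).prod (Measure.pi fun _ : Fin n => Q n)).real
          {ω | Ustat ω.1 ω.2 ∈ A n} -
      ((Measure.pi fun _ : Fin (m n) => P).prod (Measure.pi fun _ : Fin n => P)).real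
          {ω | Ustat ω.1 ω.2 ∈ A n}) atTop (𝓝 0) := by
  rw [Metric.tendsto_nhds]
  intro δ hδ
  have hs : Tendsto (fun n : ℕ => √2/√((n:ℝ)+1)) atTop (𝓝 0) :=
    (Real.tendsto_sqrt_atTop.comp
      (tendsto_atTop_add_const_right _ 1 tendsto_natCast_atTop_atTop)).const_div_atTop _
  have hl := ((h.const_mul (8 * √2)).add hs).const_mul (2/√((δ/64)/2))
  simp only [mul_zero, add_zero] at hl
  filter_upwards [hl.eventually_lt_const (half_pos hδ), hm.eventually_ge_atTop 32,
    eventually_ge_atTop 1] with n h1 h2 h3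
  rw [Real.dist_eq, sub_zero]
  refine (tv_main P (Q n) F hF hFcont (ε n) (μ n) (hε n).1 (hε n).2 (hμ n) (hQ n) (m n) n h2 h3
    (δ/64) (by positivity) (A n)).trans_lt ?_
  linarith

/-- In the two-sample problem, if
`√n ε_n (1/2 − ∫ F(x−μ_n) dF(x)) → 0`, then under H1 (and H0 alike) the
standardized Wilcoxon statistic `(U − mn/2)/√(mn(m+n+1)/12)` converges in
distribution to the standard normal law, so the Wilcoxon test is asymptotically
powerless: for any sequence of tests based on U, the sum of type I and type II
error probabilities cannot be bounded away from 1 (its limsup is at least 1). -/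
theorem stmt_3
    (P : Measure ℝ) [IsProbabilityMeasure P]
    (F : ℝ → ℝ) (hF : ∀ t, F t = (P (Set.Iic t)).toReal) (hFcont : Continuous F)
    (ε μ : ℕ → ℝ) (hε : ∀ n, ε n ∈ Set.Ioo (0:ℝ) (1/2)) (hμ : ∀ n, 0 < μ n)
    (η : ℝ) (hη : η ∈ Set.Ioc (0:ℝ) (1/2))
    (m : ℕ → ℕ) (hmn : ∀ᶠ n in atTop, n ≤ m n)
    (hcouple : (fun n : ℕ => (n : ℝ) / ((m n : ℝ) + n) - η)
      =O[atTop] fun n => Real.log n / Real.sqrt n)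
    (Q : ℕ → Measure ℝ) [∀ n, IsProbabilityMeasure (Q n)]
    (hQ : ∀ n, Q n = ENNReal.ofReal (1 - ε n) • P + ENNReal.ofReal (ε n) • P.map (· + μ n))
    (h : Tendsto (fun n : ℕ => Real.sqrt n * ε n *
      (1/2 - ∫ x, F (x - μ n) ∂P)) atTop (𝓝 0)) :
    (∀ x : ℝ,
      Tendsto (fun n => (((Measure.pi fun _ : Fin (m n) => P).prod
          (Measure.pi fun _ : Fin n => Q n))
          {ω | ((Ustat ω.1 ω.2 : ℝ) - (m n : ℝ) * n / 2) /
            Real.sqrt ((m n : ℝ) * n * ((m n : ℝ) + n + 1) / 12) ≤ x}).toReal)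
        atTop (𝓝 ((gaussianReal 0 1 (Set.Iic x)).toReal)) ∧
      Tendsto (fun n => (((Measure.pi fun _ : Fin (m n) => P).prod
          (Measure.pi fun _ : Fin n => P))
          {ω | ((Ustat ω.1 ω.2 : ℝ) - (m n : ℝ) * n / 2) /
            Real.sqrt ((m n : ℝ) * n * ((m n : ℝ) + n + 1) / 12) ≤ x}).toReal)
        atTop (𝓝 ((gaussianReal 0 1 (Set.Iic x)).toReal))) ∧
    (∀ A : ℕ → Set ℕ,
      1 ≤ Filter.limsup (fun n =>
        (((Measure.pi fun _ : Fin (m n) => P).prod (Measure.pi fun _ : Fin n => P))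
          {ω | Ustat ω.1 ω.2 ∈ A n}).toReal +
        (((Measure.pi fun _ : Fin (m n) => P).prod (Measure.pi fun _ : Fin n => Q n))
          {ω | Ustat ω.1 ω.2 ∉ A n}).toReal) atTop) := by
  have hm : Tendsto m atTop atTop := tendsto_atTop_mono' atTop hmn tendsto_id
  have htv := tv_tendsto P F hF hFcont ε μ hε hμ m hm Q hQ h
  refine ⟨fun x => ?_, fun A => ?_⟩
  · have h0 := H0_clt P F hF hFcont m hm x
    refine ⟨?_, h0⟩
    have h1 := (htv (fun n => {k : ℕ | ((k : ℝ) - (m n : ℝ) * n / 2) /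
            Real.sqrt ((m n : ℝ) * n * ((m n : ℝ) + n + 1) / 12) ≤ x})).add h0
    rw [zero_add] at h1
    refine h1.congr fun n => ?_
    simp only [Measure.real, Set.mem_setOf_eq]
    ring
  · have h1 := (htv A).const_sub 1
    rw [sub_zero] at h1
    refine le_of_eq (Tendsto.limsup_eq (h1.congr fun n => ?_)).symm
    have hms : MeasurableSet {ω : (Fin (m n) → ℝ) × (Fin n → ℝ) | Ustat ω.1 ω.2 ∈ A n} :=
      Ustat_meas (m n) n (MeasurableSet.of_discrete (s := A n))
    have hc := probReal_compl_eq_one_sub (μ := (Measure.pi fun _ : Fin (m n) => P).prod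
      (Measure.pi fun _ : Fin n => Q n)) hms
    have hc2 : (((Measure.pi fun _ : Fin (m n) => P).prod (Measure.pi fun _ : Fin n => Q n))
          {ω | Ustat ω.1 ω.2 ∉ A n}).toReal = 1 - ((Measure.pi fun _ : Fin (m n) => P).prod
      (Measure.pi fun _ : Fin n => Q n)).real {ω | Ustat ω.1 ω.2 ∈ A n} := hc
    rw [hc2]
    simp only [Measure.real]
    ring
end

section
/- Consider the two-sample testing problem with alternative parameters ε = ε_n ∈ (0,1/2) and μ = μ_n > 0 possibly varying with n. If √n ε_n · sup_{t∈ℝ} (F(t) − F(t − μ_n)) → ∞ as n → ∞, then under the alternative H1 the normalized statistic √(mn/(m+n)) D_{m,n} tends to ∞ in probability; since under the null H0 this statistic converges in distribution to the (finite) Kolmogorov limit law, the two-sample Kolmogorov–Smirnov test is asymptotically powerful. -/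
open MeasureTheory ProbabilityTheory Filter Set Topology

/-- Empirical CDF of a sample of size `k`. -/
noncomputable def empCDF {k : ℕ} (x : Fin k → ℝ) (t : ℝ) : ℝ :=
  ((Finset.univ.filter fun i => x i ≤ t).card : ℝ) / k

/-- The one-sided two-sample Kolmogorov–Smirnov statistic
`D_{m,n} = sup_t (F_m(t) − G_n(t))`. -/
noncomputable def KSstat {m n : ℕ} (x : Fin m → ℝ) (y : Fin n → ℝ) : ℝ :=
  ⨆ t : ℝ, (empCDF x t - empCDF y t)

lemma empCDF_mem {k : ℕ} (x : Fin k → ℝ) (t : ℝ) : 0 ≤ empCDF x t ∧ empCDF x t ≤ 1 := by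
  unfold empCDF
  refine ⟨by positivity, ?_⟩
  apply div_le_one_of_le₀ _ (by positivity)
  have := Finset.card_le_univ (Finset.univ.filter fun i => x i ≤ t)
  simp only [Fintype.card_fin] at this
  exact_mod_cast this

lemma le_KSstat {m n : ℕ} (x : Fin m → ℝ) (y : Fin n → ℝ) (t : ℝ) :
    empCDF x t - empCDF y t ≤ KSstat x y := by
  unfold KSstat
  refine le_ciSup (f := fun t => empCDF x t - empCDF y t) ⟨1, ?_⟩ t
  rintro _ ⟨s, rfl⟩
  have h1 := empCDF_mem x s
  have h2 := empCDF_mem y s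
  simp only
  linarith [h1.2, h2.1]

lemma empCDF_cheb (P : Measure ℝ) [IsProbabilityMeasure P] (k : ℕ) (hk : 0 < k) (t δ : ℝ)
    (hδ : 0 < δ) :
    (Measure.pi fun _ : Fin k => P) {x | δ ≤ |empCDF x t - (P (Set.Iic t)).toReal|}
      ≤ ENNReal.ofReal (1 / (k * δ ^ 2)) := by
  have hk' : (0:ℝ) < k := by exact_mod_cast hk
  set f : ℝ → ℝ := (Set.Iic t).indicator fun _ => (1:ℝ) with hf
  have hfm : Measurable f := measurable_const.indicator measurableSet_Iic
  have hfb : ∀ x, f x ∈ Set.Icc (0:ℝ) 1 := by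
    intro x
    by_cases hx : x ∈ Set.Iic t <;> simp [hf, hx]
  have hf2 : MemLp f 2 P := memLp_of_bounded (Eventually.of_forall hfb) hfm.aestronglyMeasurable 2
  have hvar : variance f P ≤ 1 := by
    have := variance_le_sq_of_bounded (μ := P) (Eventually.of_forall hfb) hfm.aemeasurable
    norm_num at this
    linarith
  have hint : ∫ x, f x ∂P = (P (Set.Iic t)).toReal := by
    simp [hf, integral_indicator measurableSet_Iic, Measure.real]
  set S : (Fin k → ℝ) → ℝ := ∑ i : Fin k, fun ω => f (ω i) with hS
  have hemp : ∀ x : Fin k → ℝ, empCDF x t = S x / k := by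
    intro x
    unfold empCDF
    simp [hS, hf, Set.indicator_apply]
  have hi2 : ∀ i : Fin k, MemLp (fun ω : Fin k → ℝ => f (ω i)) 2 (Measure.pi fun _ : Fin k => P) :=
    fun i => hf2.comp_measurePreserving (measurePreserving_eval (fun _ : Fin k => P) i)
  have hS2 : MemLp S 2 (Measure.pi fun _ : Fin k => P) :=
    memLp_finsetSum' _ fun i _ => hi2 i
  have hES : ∫ x, S x ∂(Measure.pi fun _ : Fin k => P) = k * (P (Set.Iic t)).toReal := by
    simp only [hS, Finset.sum_apply]
    rw [integral_finsetSum _ fun i _ => (hi2 i).integrable (by norm_num)]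
    have : ∀ i : Fin k, ∫ x : Fin k → ℝ, f (x i) ∂(Measure.pi fun _ : Fin k => P)
        = (P (Set.Iic t)).toReal := by
      intro i
      rw [← hint]
      exact integral_comp_eval (μ := fun _ : Fin k => P) (i := i) hfm.aestronglyMeasurable
    simp [this]
  have hVS : variance S (Measure.pi fun _ : Fin k => P) ≤ k := by
    rw [hS, variance_sum_pi (μ := fun _ : Fin k => P) (X := fun _ => f) fun _ => hf2]
    simp only [Finset.sum_const, Finset.card_univ, Fintype.card_fin, nsmul_eq_mul]
    nlinarith
  have hch := meas_ge_le_variance_div_sq hS2 (c := k * δ) (by positivity)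
  rw [hES] at hch
  have hset : {x : Fin k → ℝ | δ ≤ |empCDF x t - (P (Set.Iic t)).toReal|}
      = {x | k * δ ≤ |S x - k * (P (Set.Iic t)).toReal|} := by
    ext x
    simp only [Set.mem_setOf_eq, hemp]
    have : S x - k * (P (Set.Iic t)).toReal = k * (S x / k - (P (Set.Iic t)).toReal) := by
      field_simp
    rw [this, abs_mul, abs_of_pos hk', mul_le_mul_iff_right₀ hk']
  rw [hset]
  refine hch.trans (ENNReal.ofReal_le_ofReal ?_)
  have : (1:ℝ) / (k * δ ^ 2) = k / (k * δ) ^ 2 := by field_simp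
  rw [this]
  gcongr

lemma KS_main (P Q : Measure ℝ) [IsProbabilityMeasure P] [IsProbabilityMeasure Q]
    (m n : ℕ) (hn : 0 < n) (hmn : n ≤ m) (t d a C : ℝ) (ha : 0 < a) (hC : 8 * C < a)
    (hd : (P (Set.Iic t)).toReal - (Q (Set.Iic t)).toReal = d)
    (had : a / 2 ≤ Real.sqrt n * d) :
    1 - 128 / a ^ 2 ≤ (((Measure.pi fun _ : Fin m => P).prod
          (Measure.pi fun _ : Fin n => Q))
          {ω | C < Real.sqrt (((m : ℝ) * n) / ((m : ℝ) + n)) *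
            KSstat ω.1 ω.2}).toReal := by
  have hn' : (0:ℝ) < n := by exact_mod_cast hn
  have hmn' : (n:ℝ) ≤ m := by exact_mod_cast hmn
  have hm' : (0:ℝ) < m := by linarith
  have hsn : 0 < Real.sqrt n := Real.sqrt_pos.2 hn'
  have hsq : Real.sqrt n ^ 2 = n := Real.sq_sqrt hn'.le
  have hdpos : 0 < d := by
    by_contra hcon
    push Not at hcon
    nlinarith
  set A : Set (Fin m → ℝ) := {x | d / 4 ≤ |empCDF x t - (P (Set.Iic t)).toReal|} with hA
  set B : Set (Fin n → ℝ) := {x | d / 4 ≤ |empCDF x t - (Q (Set.Iic t)).toReal|} with hB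
  set S : Set ((Fin m → ℝ) × (Fin n → ℝ)) :=
    {ω | C < Real.sqrt (((m : ℝ) * n) / ((m : ℝ) + n)) * KSstat ω.1 ω.2} with hS
  have hbound : (1:ℝ) / (n * (d / 4) ^ 2) ≤ 64 / a ^ 2 := by
    have h1 : a ^ 2 / 4 ≤ n * d ^ 2 := by
      rw [← hsq]
      nlinarith
    rw [div_le_div_iff₀ (by positivity) (by positivity)]
    nlinarith
  have hPA : (Measure.pi fun _ : Fin m => P) A ≤ ENNReal.ofReal (64 / a ^ 2) := by
    refine (empCDF_cheb P m (by omega) t (d / 4) (by positivity)).trans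
      (ENNReal.ofReal_le_ofReal (le_trans ?_ hbound))
    gcongr
  have hQB : (Measure.pi fun _ : Fin n => Q) B ≤ ENNReal.ofReal (64 / a ^ 2) :=
    (empCDF_cheb Q n hn t (d / 4) (by positivity)).trans (ENNReal.ofReal_le_ofReal hbound)
  have hfac : Real.sqrt n / 2 ≤ Real.sqrt (((m : ℝ) * n) / ((m : ℝ) + n)) := by
    apply Real.le_sqrt_of_sq_le
    rw [div_pow, hsq, div_le_div_iff₀ (by positivity) (by positivity)]
    nlinarith
  have hcover : (Set.univ : Set ((Fin m → ℝ) × (Fin n → ℝ)))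
      ⊆ S ∪ (A ×ˢ Set.univ ∪ Set.univ ×ˢ B) := by
    rintro ⟨x, y⟩ -
    by_cases hx : x ∈ A
    · right; left; exact ⟨hx, trivial⟩
    by_cases hy : y ∈ B
    · right; right; exact ⟨trivial, hy⟩
    left
    simp only [hA, hB, Set.mem_setOf_eq, not_le] at hx hy
    simp only [hS, Set.mem_setOf_eq]
    have h1 := (abs_lt.1 hx).1
    have h2 := (abs_lt.1 hy).2
    have h3 : d / 2 ≤ KSstat x y := by
      have := le_KSstat x y t
      linarith
    have h4 : Real.sqrt n / 2 * (d / 2) ≤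
        Real.sqrt (((m : ℝ) * n) / ((m : ℝ) + n)) * KSstat x y := by
      gcongr
    linarith
  set M := (Measure.pi fun _ : Fin m => P).prod (Measure.pi fun _ : Fin n => Q) with hM
  have h1 : (1 : ENNReal) ≤ M S + (ENNReal.ofReal (64 / a ^ 2) + ENNReal.ofReal (64 / a ^ 2)) := by
    calc (1 : ENNReal) = M Set.univ := measure_univ.symm
      _ ≤ M (S ∪ (A ×ˢ Set.univ ∪ Set.univ ×ˢ B)) := measure_mono hcover
      _ ≤ M S + M (A ×ˢ Set.univ ∪ Set.univ ×ˢ B) := measure_union_le _ _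
      _ ≤ M S + (M (A ×ˢ Set.univ) + M (Set.univ ×ˢ B)) := by
        gcongr
        exact measure_union_le _ _
      _ ≤ _ := by
        rw [hM, Measure.prod_prod, Measure.prod_prod, measure_univ, measure_univ, mul_one, one_mul]
        gcongr
  have hfin : M S ≠ ⊤ := measure_ne_top _ _
  have h2 := ENNReal.toReal_mono (by finiteness) h1
  rw [ENNReal.toReal_add hfin (by finiteness), ENNReal.toReal_add (by finiteness) (by finiteness),
    ENNReal.toReal_ofReal (by positivity), ENNReal.toReal_one] at h2
  have : (128:ℝ) / a ^ 2 = 64 / a ^ 2 + 64 / a ^ 2 := by ring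
  linarith

/-- In the two-sample problem, if
`√n ε_n · sup_t (F(t) − F(t−μ_n)) → ∞`, then under H1 the normalized statistic
`√(mn/(m+n)) D_{m,n}` tends to ∞ in probability (hence, the null statistic
converging in distribution to the finite Kolmogorov limit law, the two-sample
Kolmogorov–Smirnov test is asymptotically powerful). -/
theorem stmt_4
    (P : Measure ℝ) [IsProbabilityMeasure P]
    (F : ℝ → ℝ) (hF : ∀ t, F t = (P (Set.Iic t)).toReal) (hFcont : Continuous F)
    (ε μ : ℕ → ℝ) (hε : ∀ n, ε n ∈ Set.Ioo (0:ℝ) (1/2)) (hμ : ∀ n, 0 < μ n)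
    (η : ℝ) (hη : η ∈ Set.Ioc (0:ℝ) (1/2))
    (m : ℕ → ℕ) (hmn : ∀ᶠ n in atTop, n ≤ m n)
    (hcouple : (fun n : ℕ => (n : ℝ) / ((m n : ℝ) + n) - η)
      =O[atTop] fun n => Real.log n / Real.sqrt n)
    (Q : ℕ → Measure ℝ) [∀ n, IsProbabilityMeasure (Q n)]
    (hQ : ∀ n, Q n = ENNReal.ofReal (1 - ε n) • P + ENNReal.ofReal (ε n) • P.map (· + μ n))
    (h : Tendsto (fun n : ℕ => Real.sqrt n * ε n *
      ⨆ t : ℝ, (F t - F (t - μ n))) atTop atTop) :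
    ∀ C : ℝ,
      Tendsto (fun n => (((Measure.pi fun _ : Fin (m n) => P).prod
          (Measure.pi fun _ : Fin n => Q n))
          {ω | C < Real.sqrt (((m n : ℝ) * n) / ((m n : ℝ) + n)) *
            KSstat ω.1 ω.2}).toReal) atTop (𝓝 1) := by
  intro C
  set a : ℕ → ℝ := fun n : ℕ => Real.sqrt n * ε n * ⨆ t : ℝ, (F t - F (t - μ n)) with ha
  have hlim : Tendsto (fun n => 1 - 128 / a n ^ 2) atTop (𝓝 1) := by
    have h2 : Tendsto (fun n => a n ^ 2) atTop atTop :=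
      (tendsto_pow_atTop (by norm_num)).comp h
    simpa using (h2.const_div_atTop 128).const_sub 1
  refine tendsto_of_tendsto_of_tendsto_of_le_of_le' hlim tendsto_const_nhds ?_
    (Eventually.of_forall fun n => ?_)
  swap
  · exact ENNReal.toReal_le_of_le_ofReal zero_le_one (by simpa using prob_le_one)
  filter_upwards [hmn, eventually_gt_atTop 0, h.eventually_gt_atTop 0,
    h.eventually_gt_atTop (8 * C)] with n hmn hn ha0 haC
  change 0 < a n at ha0
  change 8 * C < a n at haC
  have hε0 := (hε n).1
  have hε1 := (hε n).2
  have hn' : (0:ℝ) < n := by exact_mod_cast hn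
  have hsn : 0 < Real.sqrt n := Real.sqrt_pos.2 hn'
  have hsup : 0 < ⨆ t : ℝ, (F t - F (t - μ n)) :=
    pos_of_mul_pos_right ha0 (by positivity)
  obtain ⟨t, ht⟩ := exists_lt_of_lt_ciSup (half_lt_self hsup)
  have hQt : (Q n (Set.Iic t)).toReal = (1 - ε n) * F t + ε n * F (t - μ n) := by
    rw [hQ n]
    have hpre : (fun x => x + μ n) ⁻¹' Set.Iic t = Set.Iic (t - μ n) := by
      ext x; simp [le_sub_iff_add_le]
    rw [Measure.add_apply, Measure.smul_apply, Measure.smul_apply,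
      Measure.map_apply (measurable_add_const _) measurableSet_Iic, hpre, smul_eq_mul, smul_eq_mul,
      ENNReal.toReal_add (by finiteness) (by finiteness), ENNReal.toReal_mul, ENNReal.toReal_mul,
      ENNReal.toReal_ofReal (by linarith), ENNReal.toReal_ofReal hε0.le, ← hF, ← hF]
  refine KS_main P (Q n) (m n) n hn hmn t (ε n * (F t - F (t - μ n))) (a n) C ha0 haC ?_ ?_
  · rw [hQt, ← hF]; ring
  · have h5 := mul_le_mul_of_nonneg_left ht.le (mul_pos hsn hε0).le
    simp only [ha]
    linarith
end
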